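/- arXiv:1407.6139 — 6 statements merged into one kernel-verified Lean document; each statement's English description precedes it below -/
import Mathlib

section
/- Let D be an open set in ℝ^m and let t > 0. Then H_D(t) < ∞ if and only if ∫_D μ_D(x;(8mt)^{1/2}) dx < ∞. -/
open MeasureTheory Metric Set
open scoped ENNReal

noncomputable def heatKernel (m : ℕ) (t : ℝ) (x y : EuclideanSpace ℝ (Fin m)) : ℝ :=
  (4 * Real.pi * t) ^ (-(m : ℝ) / 2) * Real.exp (-(dist x y) ^ 2 / (4 * t))

/-- Heat content as an extended-real quantity, so that `H_D(t) < ∞` is meaningful. -/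
noncomputable def heatContentENN (m : ℕ) (D : Set (EuclideanSpace ℝ (Fin m))) (t : ℝ) : ℝ≥0∞ :=
  ∫⁻ x in D, ∫⁻ y in D, ENNReal.ofReal (heatKernel m t x y)

/-- The indicator of the relation `dist x y < r`, valued in `ℝ≥0∞`. -/
noncomputable def ballKernel {E : Type*} [PseudoMetricSpace E] (r : ℝ) (x y : E) : ℝ≥0∞ :=
  (ball x r).indicator 1 y

section BallKernel

variable {E : Type*} [PseudoMetricSpace E]

theorem ballKernel_comm (r : ℝ) (x y : E) : ballKernel r x y = ballKernel r y x := by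
  classical simp [ballKernel, indicator_apply, dist_comm]

theorem ballKernel_mul_ballKernel_le {r R : ℝ} (h : r + r ≤ R) (x y z : E) :
    ballKernel r x z * ballKernel r y z ≤ ballKernel r x z * ballKernel R x y := by
  classical
  unfold ballKernel
  simp only [indicator_apply, mem_ball]
  split_ifs with h₁ h₂ h₃
  · simp
  · exact absurd (by linarith [dist_triangle_right y x z, dist_comm z y, dist_comm z x]) h₃
  all_goals simp

variable [MeasurableSpace E] [BorelSpace E]

theorem lintegral_ballKernel (μ : Measure E) (r : ℝ) (x : E) :
    ∫⁻ y, ballKernel r x y ∂μ = μ (ball x r) :=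
  lintegral_indicator_one measurableSet_ball

variable [SecondCountableTopology E]

theorem measurable_ballKernel (r : ℝ) : Measurable (fun p : E × E => ballKernel r p.1 p.2) := by
  have h : MeasurableSet {p : E × E | dist p.2 p.1 < r} :=
    measurableSet_lt (measurable_snd.dist measurable_fst) measurable_const
  exact (measurable_const (a := (1 : ℝ≥0∞))).indicator h

end BallKernel

section Schur

variable {E : Type*} [MeasurableSpace E]

theorem lintegral_lintegral_mul_mul_le (μ : Measure E) [SFinite μ] {g : E → ℝ≥0∞}
    (hg : Measurable g) {q : E → E → ℝ≥0∞} (hq : Measurable (fun p : E × E => q p.1 p.2))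
    (hsymm : ∀ z w, q z w = q w z) {Q : ℝ≥0∞} (hQ : ∀ z, ∫⁻ w, q z w ∂μ ≤ Q) :
    ∫⁻ z, ∫⁻ w, g z * (g w * q z w) ∂μ ∂μ ≤ 2 * Q * ∫⁻ z, g z ^ 2 ∂μ := by
  have hqz (z : E) : Measurable (q z) := hq.comp measurable_prodMk_left
  have diag : ∫⁻ z, ∫⁻ w, g z ^ 2 * q z w ∂μ ∂μ ≤ Q * ∫⁻ z, g z ^ 2 ∂μ := by
    rw [← lintegral_const_mul _ (hg.pow_const 2)]
    refine lintegral_mono fun z => ?_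
    rw [lintegral_const_mul _ (hqz z), mul_comm]
    exact mul_le_mul_left (hQ z) _
  have swap : ∫⁻ z, ∫⁻ w, g w ^ 2 * q z w ∂μ ∂μ = ∫⁻ z, ∫⁻ w, g z ^ 2 * q z w ∂μ ∂μ := by
    rw [lintegral_lintegral_swap
      (((hg.comp measurable_snd).pow_const 2).mul hq).aemeasurable]
    simp_rw [fun z w => hsymm w z]
  have amgm (a b : ℝ≥0∞) : a * b ≤ a ^ 2 + b ^ 2 := by
    rcases le_total a b with h | h
    · exact le_add_left (by rw [sq]; gcongr)
    · exact le_add_right (by rw [sq]; gcongr)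
  calc ∫⁻ z, ∫⁻ w, g z * (g w * q z w) ∂μ ∂μ
      ≤ ∫⁻ z, ∫⁻ w, g z ^ 2 * q z w + g w ^ 2 * q z w ∂μ ∂μ := by
        refine lintegral_mono fun z => lintegral_mono fun w => ?_
        rw [← mul_assoc, ← add_mul]
        exact mul_le_mul_left (amgm _ _) _
    _ = ∫⁻ z, ∫⁻ w, g z ^ 2 * q z w ∂μ ∂μ + ∫⁻ z, ∫⁻ w, g w ^ 2 * q z w ∂μ ∂μ := by
        rw [← lintegral_add_left]
        · exact lintegral_congr fun z => lintegral_add_left ((hqz z).const_mul _) _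
        · exact (((hg.comp measurable_fst).pow_const 2).mul hq).lintegral_prod_right'
    _ ≤ 2 * Q * ∫⁻ z, g z ^ 2 ∂μ := by
        rw [swap, ← two_mul, mul_assoc]
        gcongr

end Schur

section Averaging

variable {E : Type*} [PseudoMetricSpace E] [MeasurableSpace E] [BorelSpace E]
  [SecondCountableTopology E]

theorem measurable_measure_ball (ν : Measure E) [SFinite ν] (r : ℝ) :
    Measurable (fun z => ν (ball z r)) := by
  simp_rw [← lintegral_ballKernel]
  exact (measurable_ballKernel r).lintegral_prod_right'

theorem lintegral_measure_ball_sq_le (μ ν : Measure E) [SFinite μ] [SFinite ν] {r R : ℝ}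
    (hrR : r + r ≤ R) {v : ℝ≥0∞} (hv : ∀ x, μ (ball x r) = v) :
    ∫⁻ z, ν (ball z r) ^ 2 ∂μ ≤ v * ∫⁻ x, ν (ball x R) ∂ν := by
  have hχ := measurable_ballKernel (E := E) r
  have hχR := measurable_ballKernel (E := E) R
  have hχz (z : E) : Measurable (ballKernel r z) := hχ.comp measurable_prodMk_left
  have hχRx (x : E) : Measurable (ballKernel R x) := hχR.comp measurable_prodMk_left
  calc ∫⁻ z, ν (ball z r) ^ 2 ∂μ
      = ∫⁻ z, ∫⁻ x, ∫⁻ y, ballKernel r x z * ballKernel r y z ∂ν ∂ν ∂μ := by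
        refine lintegral_congr fun z => ?_
        simp_rw [fun x => ballKernel_comm r x z]
        simp_rw [lintegral_const_mul _ (hχz z)]
        rw [lintegral_mul_const _ (hχz z), lintegral_ballKernel, sq]
    _ ≤ ∫⁻ z, ∫⁻ x, ∫⁻ y, ballKernel r x z * ballKernel R x y ∂ν ∂ν ∂μ :=
        lintegral_mono fun z => lintegral_mono fun x => lintegral_mono fun y =>
          ballKernel_mul_ballKernel_le hrR x y z
    _ = ∫⁻ z, ∫⁻ x, ballKernel r x z * ν (ball x R) ∂ν ∂μ := by
        simp_rw [lintegral_const_mul _ (hχRx _), lintegral_ballKernel]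
    _ = ∫⁻ x, ∫⁻ z, ballKernel r x z * ν (ball x R) ∂μ ∂ν := by
        refine lintegral_lintegral_swap (Measurable.aemeasurable ?_)
        exact (hχ.comp measurable_swap).mul
          ((measurable_measure_ball ν R).comp measurable_snd)
    _ = v * ∫⁻ x, ν (ball x R) ∂ν := by
        simp_rw [lintegral_mul_const _ (hχz _), lintegral_ballKernel, hv]
        exact lintegral_const_mul _ (measurable_measure_ball ν R)

theorem mul_lintegral_lintegral_le (μ ν : Measure E) [SFinite μ] [SFinite ν] {r : ℝ} {v : ℝ≥0∞}
    (hv_top : v ≠ ⊤) (hv : ∀ x, μ (ball x r) = v) {K q : E → E → ℝ≥0∞}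
    (hq : Measurable (fun p : E × E => q p.1 p.2))
    (hK : ∀ x y, ∀ z ∈ ball x r, ∀ w ∈ ball y r, K x y ≤ q z w) :
    v * v * ∫⁻ x, ∫⁻ y, K x y ∂ν ∂ν ≤
      ∫⁻ z, ∫⁻ w, ν (ball z r) * (ν (ball w r) * q z w) ∂μ ∂μ := by
  have hχ := measurable_ballKernel (E := E) r
  have hχz (z : E) : Measurable (ballKernel r z) := hχ.comp measurable_prodMk_left
  have hqz (z : E) : Measurable (q z) := hq.comp measurable_prodMk_left
  have hf : Measurable (fun p : E × E => ∫⁻ w, ballKernel r p.1 w * q p.2 w ∂μ) := by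
    refine Measurable.lintegral_prod_right'
      (f := fun s : (E × E) × E => ballKernel r s.1.1 s.2 * q s.1.2 s.2) ?_
    exact (hχ.comp ((measurable_fst.comp measurable_fst).prodMk measurable_snd)).mul
      (hq.comp ((measurable_snd.comp measurable_fst).prodMk measurable_snd))
  have hF : Measurable (fun z => ∫⁻ y, ∫⁻ w, ballKernel r y w * q z w ∂μ ∂ν) :=
    (hf.comp measurable_swap).lintegral_prod_right'
  have pointwise (x y : E) :
      v * v * K x y ≤ ∫⁻ z, ballKernel r x z * ∫⁻ w, ballKernel r y w * q z w ∂μ ∂μ := by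
    calc v * v * K x y
        = ∫⁻ z, ballKernel r x z * ∫⁻ w, ballKernel r y w * K x y ∂μ ∂μ := by
          rw [lintegral_mul_const _ (hχz y), lintegral_mul_const _ (hχz x),
            lintegral_ballKernel, lintegral_ballKernel, hv, hv, mul_assoc]
      _ ≤ _ := by
          refine lintegral_mono fun z => ?_
          by_cases hz : z ∈ ball x r
          · refine mul_le_mul_right (lintegral_mono fun w => ?_) _
            by_cases hw : w ∈ ball y r
            · exact mul_le_mul_right (hK x y z hz w hw) _
            · simp [ballKernel, hw]
          · simp [ballKernel, hz]
  have inner (z : E) : ∫⁻ y, ∫⁻ w, ballKernel r y w * q z w ∂μ ∂ν =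
      ∫⁻ w, ν (ball w r) * q z w ∂μ := by
    rw [lintegral_lintegral_swap (hχ.mul ((hqz z).comp measurable_snd)).aemeasurable]
    refine lintegral_congr fun w => ?_
    simp_rw [fun y => ballKernel_comm r y w]
    rw [lintegral_mul_const _ (hχz w), lintegral_ballKernel]
  calc v * v * ∫⁻ x, ∫⁻ y, K x y ∂ν ∂ν
      = ∫⁻ x, ∫⁻ y, v * v * K x y ∂ν ∂ν := by
        have hvv : v * v ≠ ⊤ := ENNReal.mul_ne_top hv_top hv_top
        simp_rw [lintegral_const_mul' _ _ hvv]
    _ ≤ ∫⁻ x, ∫⁻ y, ∫⁻ z, ballKernel r x z * ∫⁻ w, ballKernel r y w * q z w ∂μ ∂μ ∂ν ∂ν :=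
        lintegral_mono fun x => lintegral_mono fun y => pointwise x y
    _ = ∫⁻ x, ∫⁻ z, ballKernel r x z * ∫⁻ y, ∫⁻ w, ballKernel r y w * q z w ∂μ ∂ν ∂μ ∂ν := by
        refine lintegral_congr fun x => ?_
        rw [lintegral_lintegral_swap (((hχz x).comp measurable_snd).mul hf).aemeasurable]
        exact lintegral_congr fun z =>
          lintegral_const_mul _ (hf.comp measurable_prodMk_right)
    _ = ∫⁻ z, ν (ball z r) * ∫⁻ y, ∫⁻ w, ballKernel r y w * q z w ∂μ ∂ν ∂μ := by
        rw [lintegral_lintegral_swap (hχ.mul (hF.comp measurable_snd)).aemeasurable]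
        refine lintegral_congr fun z => ?_
        simp_rw [fun x => ballKernel_comm r x z]
        rw [lintegral_mul_const _ (hχz z), lintegral_ballKernel]
    _ = ∫⁻ z, ∫⁻ w, ν (ball z r) * (ν (ball w r) * q z w) ∂μ ∂μ := by
        refine lintegral_congr fun z => ?_
        rw [inner]
        exact (lintegral_const_mul _ ((measurable_measure_ball ν r).mul (hqz z))).symm

end Averaging

theorem heatKernel_le_of_dist_lt {m : ℕ} {t r : ℝ} (ht : 0 < t)
    {x y z w : EuclideanSpace ℝ (Fin m)} (hz : dist z x < r) (hw : dist w y < r) :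
    heatKernel m t x y ≤ (4 * Real.pi * t) ^ (-(m : ℝ) / 2) * Real.exp (r ^ 2 / t) *
      Real.exp (-(1 / (8 * t)) * ‖z - w‖ ^ 2) := by
  have hA : 0 ≤ (4 * Real.pi * t) ^ (-(m : ℝ) / 2) := by positivity
  rw [heatKernel, mul_assoc _ (Real.exp _), ← Real.exp_add]
  refine mul_le_mul_of_nonneg_left (Real.exp_le_exp.2 ?_) hA
  rw [← dist_eq_norm]
  have htri : dist z w ≤ dist x y + 2 * r := by
    linarith [dist_triangle4 z x y w, dist_comm w y]
  have hsq : dist z w ^ 2 ≤ 2 * dist x y ^ 2 + 8 * r ^ 2 := by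
    nlinarith [sq_nonneg (dist x y - 2 * r), dist_nonneg (x := z) (y := w),
      pow_le_pow_left₀ (dist_nonneg (x := z) (y := w)) htri 2]
  have key : r ^ 2 / t + -(1 / (8 * t)) * dist z w ^ 2 - -dist x y ^ 2 / (4 * t) =
      (2 * dist x y ^ 2 + 8 * r ^ 2 - dist z w ^ 2) / (8 * t) := by
    field_simp
    ring
  have : 0 ≤ (2 * dist x y ^ 2 + 8 * r ^ 2 - dist z w ^ 2) / (8 * t) :=
    div_nonneg (by linarith) (by positivity)
  linarith

theorem le_heatKernel_of_dist_lt {m : ℕ} {t R : ℝ} (ht : 0 < t)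
    {x y : EuclideanSpace ℝ (Fin m)} (h : dist x y < R) :
    (4 * Real.pi * t) ^ (-(m : ℝ) / 2) * Real.exp (-R ^ 2 / (4 * t)) ≤ heatKernel m t x y := by
  unfold heatKernel
  gcongr

theorem lintegral_gaussian_lt_top {E : Type*} [NormedAddCommGroup E] [InnerProductSpace ℝ E]
    [FiniteDimensional ℝ E] [MeasurableSpace E] [BorelSpace E] {b : ℝ} (hb : 0 < b) (c : ℝ) :
    ∫⁻ v : E, ENNReal.ofReal (c * Real.exp (-b * ‖v‖ ^ 2)) < ⊤ := by
  have h : Integrable (fun v : E => Real.exp (-b * ‖v‖ ^ 2)) := by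
    have := (GaussianFourier.integrable_cexp_neg_mul_sq_norm_add (V := E) (b := (b : ℂ))
      (by simpa using hb) 0 0).norm
    refine this.congr (Filter.Eventually.of_forall fun v => ?_)
    simp [Complex.norm_exp, ← Complex.ofReal_pow]
  exact (h.const_mul c).lintegral_lt_top

theorem heatContentENN_lt_top_of_lintegral_ball_lt_top {m : ℕ}
    {D : Set (EuclideanSpace ℝ (Fin m))} {t R : ℝ} (ht : 0 < t) (hR : 0 < R)
    (h : ∫⁻ x in D, volume (ball x R ∩ D) < ⊤) : heatContentENN m D t < ⊤ := by
  set v : ℝ≥0∞ := volume (ball (0 : EuclideanSpace ℝ (Fin m)) (R / 2))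
  have hv (x : EuclideanSpace ℝ (Fin m)) : volume (ball x (R / 2)) = v :=
    Measure.addHaar_ball_center _ _ _
  have hv_top : v ≠ ⊤ := measure_ball_lt_top.ne
  have hv_pos : v ≠ 0 := (measure_ball_pos _ _ (half_pos hR)).ne'
  set c : ℝ := (4 * Real.pi * t) ^ (-(m : ℝ) / 2) * Real.exp ((R / 2) ^ 2 / t)
  set G : EuclideanSpace ℝ (Fin m) → ℝ≥0∞ :=
    fun u => ENNReal.ofReal (c * Real.exp (-(1 / (8 * t)) * ‖u‖ ^ 2)) with hG
  have hG_top : ∫⁻ u, G u < ⊤ := lintegral_gaussian_lt_top (by positivity) c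
  have hq : Measurable (fun p : EuclideanSpace ℝ (Fin m) × EuclideanSpace ℝ (Fin m) => G (p.1 - p.2)) := by
    refine Measurable.comp (g := G) ?_ (measurable_fst.sub measurable_snd)
    fun_prop
  have hsymm (z w : EuclideanSpace ℝ (Fin m)) : G (z - w) = G (w - z) := by simp only [hG, norm_sub_rev]
  have hQ (z : EuclideanSpace ℝ (Fin m)) : ∫⁻ w, G (z - w) ≤ ∫⁻ u, G u := by
    simp_rw [hsymm z]
    exact (lintegral_sub_right_eq_self G z).le
  have hball : ∫⁻ x in D, (volume.restrict D) (ball x R) < ⊤ := by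
    simpa only [Measure.restrict_apply measurableSet_ball] using h
  have bound := mul_lintegral_lintegral_le volume (volume.restrict D) hv_top hv
    (K := fun x y => ENNReal.ofReal (heatKernel m t x y)) hq
    (fun x y z hz w hw => ENNReal.ofReal_le_ofReal (heatKernel_le_of_dist_lt ht hz hw))
  have schur := lintegral_lintegral_mul_mul_le volume
    (measurable_measure_ball (volume.restrict D) (R / 2)) hq hsymm hQ
  have sq_le := lintegral_measure_ball_sq_le volume (volume.restrict D) (add_halves R).le hv
  have fin : v * v * heatContentENN m D t < ⊤ := by
    refine (bound.trans schur).trans_lt (ENNReal.mul_lt_top ?_ (sq_le.trans_lt ?_))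
    · exact ENNReal.mul_lt_top ENNReal.ofNat_lt_top hG_top
    · exact ENNReal.mul_lt_top hv_top.lt_top hball
  exact ENNReal.lt_top_of_mul_ne_top_right fin.ne (mul_ne_zero hv_pos hv_pos)

theorem lintegral_ball_lt_top_of_heatContentENN_lt_top {m : ℕ}
    {D : Set (EuclideanSpace ℝ (Fin m))} {t : ℝ} (R : ℝ) (ht : 0 < t)
    (h : heatContentENN m D t < ⊤) : ∫⁻ x in D, volume (ball x R ∩ D) < ⊤ := by
  set c : ℝ≥0∞ := ENNReal.ofReal
    ((4 * Real.pi * t) ^ (-(m : ℝ) / 2) * Real.exp (-R ^ 2 / (4 * t))) with hc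
  have hc_pos : c ≠ 0 := by
    rw [hc, Ne, ENNReal.ofReal_eq_zero, not_le]
    positivity
  have hc_top : c ≠ ⊤ := ENNReal.ofReal_ne_top
  have le : c * ∫⁻ x in D, volume (ball x R ∩ D) ≤ heatContentENN m D t := by
    rw [← lintegral_const_mul' _ _ hc_top]
    refine lintegral_mono fun x => ?_
    calc c * volume (ball x R ∩ D) = ∫⁻ _ in ball x R, c ∂volume.restrict D := by
          rw [setLIntegral_const, Measure.restrict_apply measurableSet_ball]
      _ ≤ ∫⁻ y in ball x R, ENNReal.ofReal (heatKernel m t x y) ∂volume.restrict D :=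
          setLIntegral_mono' measurableSet_ball fun y hy => ENNReal.ofReal_le_ofReal
            (le_heatKernel_of_dist_lt ht (by simpa [dist_comm] using hy))
      _ ≤ _ := setLIntegral_le_lintegral _ _
  exact ENNReal.lt_top_of_mul_ne_top_right (le.trans_lt h).ne hc_pos

theorem heatContent_finite_iff (m : ℕ) (D : Set (EuclideanSpace ℝ (Fin m))) (hD : IsOpen D)
    (t : ℝ) (ht : 0 < t) :
    heatContentENN m D t < ⊤ ↔
      (∫⁻ x in D, volume (ball x (Real.sqrt (8 * m * t)) ∩ D)) < ⊤ := by
  refine ⟨lintegral_ball_lt_top_of_heatContentENN_lt_top _ ht, fun h => ?_⟩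
  rcases Nat.eq_zero_or_pos m with rfl | hm
  · refine heatContentENN_lt_top_of_lintegral_ball_lt_top ht one_pos ?_
    have hfin (s : Set (EuclideanSpace ℝ (Fin 0))) : volume s < ⊤ :=
      (Set.toFinite s).isCompact.measure_lt_top
    calc ∫⁻ x in D, volume (ball x 1 ∩ D) ≤ ∫⁻ _ in D, volume univ :=
          lintegral_mono fun x => measure_mono (subset_univ _)
      _ < ⊤ := by
          rw [setLIntegral_const]
          exact ENNReal.mul_lt_top (hfin _) (hfin _)
  · exact heatContentENN_lt_top_of_lintegral_ball_lt_top ht (by positivity) h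
end

section
/- Let D be an open set in ℝ^m. If H_D(t) < ∞ for some t > 0, then H_D(t) < ∞ for all t > 0. -/
open MeasureTheory Metric Set
open scoped ENNReal

section Gaussian

variable {V : Type*} [NormedAddCommGroup V]

/-- The unnormalised Gaussian kernel `exp (-a * |x - y|²)`, with values in `ℝ≥0∞`. -/
noncomputable def gaussKernel (a : ℝ) (x y : V) : ℝ≥0∞ :=
  ENNReal.ofReal (Real.exp (-a * ‖x - y‖ ^ 2))

lemma gaussKernel_comm (a : ℝ) (x y : V) : gaussKernel a x y = gaussKernel a y x := by
  simp only [gaussKernel, norm_sub_rev]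

lemma gaussKernel_anti {a b : ℝ} (h : a ≤ b) (x y : V) : gaussKernel b x y ≤ gaussKernel a x y := by
  unfold gaussKernel
  gcongr

/-- The parallelogram law for Gaussian kernels. -/
lemma gaussKernel_mul_gaussKernel [InnerProductSpace ℝ V] (a : ℝ) (x y z : V) :
    gaussKernel a x y * gaussKernel a x z =
      gaussKernel (a / 2) y z * gaussKernel (2 * a) x ((2 : ℝ)⁻¹ • (y + z)) := by
  have key := parallelogram_law_with_norm ℝ (x - y) (x - z)
  have h1 : (x - y) + (x - z) = (2 : ℝ) • (x - (2 : ℝ)⁻¹ • (y + z)) := by module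
  have h2 : (x - y) - (x - z) = -(y - z) := by abel
  rw [h1, h2, norm_neg, norm_smul] at key
  simp only [Real.norm_ofNat] at key
  unfold gaussKernel
  rw [← ENNReal.ofReal_mul (Real.exp_nonneg _), ← ENNReal.ofReal_mul (Real.exp_nonneg _),
    ← Real.exp_add, ← Real.exp_add]
  congr 2
  linear_combination (a / 2) * key

variable [MeasurableSpace V] [BorelSpace V]

@[fun_prop]
lemma measurable_gaussKernel [SecondCountableTopology V] {α : Type*} [MeasurableSpace α] (a : ℝ)
    {f g : α → V} (hf : Measurable f) (hg : Measurable g) :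
    Measurable (fun p => gaussKernel a (f p) (g p)) :=
  ((hf.sub hg).norm.pow_const 2 |>.const_mul (-a)).exp.ennreal_ofReal

variable [InnerProductSpace ℝ V] [FiniteDimensional ℝ V]

/-- The total mass of the Gaussian kernel. -/
lemma lintegral_gaussKernel {a : ℝ} (ha : 0 < a) (y : V) :
    ∫⁻ x, gaussKernel a x y =
      ENNReal.ofReal ((Real.pi / a) ^ (Module.finrank ℝ V / 2 : ℝ)) := by
  have hI := GaussianFourier.integral_rexp_neg_mul_sq_norm (V := V) ha
  have hpos : 0 < (Real.pi / a) ^ (Module.finrank ℝ V / 2 : ℝ) := by positivity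
  have hint : Integrable (fun v : V => Real.exp (-a * ‖v‖ ^ 2)) :=
    not_imp_comm.1 integral_undef (by rw [hI]; exact hpos.ne')
  rw [← hI, ofReal_integral_eq_lintegral_ofReal hint (ae_of_all _ fun _ => Real.exp_nonneg _)]
  exact lintegral_sub_right_eq_self (fun v : V => ENNReal.ofReal (Real.exp (-a * ‖v‖ ^ 2))) y

/-- The convolution of two Gaussian kernels. -/
lemma lintegral_gaussKernel_mul {a : ℝ} (ha : 0 < a) (y z : V) :
    ∫⁻ x, gaussKernel a x y * gaussKernel a x z =
      ENNReal.ofReal ((Real.pi / (2 * a)) ^ (Module.finrank ℝ V / 2 : ℝ)) *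
        gaussKernel (a / 2) y z := by
  simp_rw [gaussKernel_mul_gaussKernel]
  rw [lintegral_const_mul _ (by fun_prop), lintegral_gaussKernel (by positivity), mul_comm]

/-- The Gaussian energy of a measure is a multiple of the squared norm of its Gaussian potential. -/
lemma lintegral_potential_sq {a : ℝ} (ha : 0 < a) (μ : Measure V) [SFinite μ] :
    ∫⁻ x, (∫⁻ y, gaussKernel a x y ∂μ) ^ 2 =
      ENNReal.ofReal ((Real.pi / (2 * a)) ^ (Module.finrank ℝ V / 2 : ℝ)) *
        ∫⁻ y, ∫⁻ z, gaussKernel (a / 2) y z ∂μ ∂μ := by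
  calc ∫⁻ x, (∫⁻ y, gaussKernel a x y ∂μ) ^ 2
      = ∫⁻ x, ∫⁻ y, ∫⁻ z, gaussKernel a x y * gaussKernel a x z ∂μ ∂μ := by
        refine lintegral_congr fun x => ?_
        rw [sq, ← lintegral_mul_const _ (by fun_prop)]
        exact lintegral_congr fun y => (lintegral_const_mul _ (by fun_prop)).symm
    _ = ∫⁻ y, (∫⁻ x, ∫⁻ z, gaussKernel a x y * gaussKernel a x z ∂μ) ∂μ := by
        refine lintegral_lintegral_swap (Measurable.aemeasurable ?_)
        exact Measurable.lintegral_prod_right' (f := fun q : (V × V) × V =>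
          gaussKernel a q.1.1 q.1.2 * gaussKernel a q.1.1 q.2) (by fun_prop)
    _ = ∫⁻ y, ∫⁻ z, (∫⁻ x, gaussKernel a x y * gaussKernel a x z) ∂μ ∂μ := by
        refine lintegral_congr fun y => lintegral_lintegral_swap (Measurable.aemeasurable ?_)
        simp only [Function.uncurry_def]
        fun_prop
    _ = _ := by
        simp_rw [lintegral_gaussKernel_mul ha]
        rw [← lintegral_const_mul' _ _ ENNReal.ofReal_ne_top]
        exact lintegral_congr fun y => lintegral_const_mul _ (by fun_prop)

/-- The Gaussian potential at scale `a / 2` is obtained by smoothing the one at scale `a`. -/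
lemma lintegral_gaussKernel_mul_potential {a : ℝ} (ha : 0 < a) (μ : Measure V) [SFinite μ]
    (z : V) :
    ∫⁻ x, gaussKernel a x z * ∫⁻ y, gaussKernel a x y ∂μ =
      ENNReal.ofReal ((Real.pi / (2 * a)) ^ (Module.finrank ℝ V / 2 : ℝ)) *
        ∫⁻ y, gaussKernel (a / 2) z y ∂μ := by
  calc ∫⁻ x, gaussKernel a x z * ∫⁻ y, gaussKernel a x y ∂μ
      = ∫⁻ x, ∫⁻ y, gaussKernel a x z * gaussKernel a x y ∂μ :=
        lintegral_congr fun x => (lintegral_const_mul _ (by fun_prop)).symm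
    _ = ∫⁻ y, (∫⁻ x, gaussKernel a x z * gaussKernel a x y) ∂μ := by
        refine lintegral_lintegral_swap (Measurable.aemeasurable ?_)
        simp only [Function.uncurry_def]
        fun_prop
    _ = _ := by
        simp_rw [lintegral_gaussKernel_mul ha]
        exact lintegral_const_mul _ (by fun_prop)

end Gaussian

/-- A weighted Cauchy–Schwarz inequality, up to a factor of two. -/
lemma sq_lintegral_mul_le {α : Type*} [MeasurableSpace α] {μ : Measure α} {g u : α → ℝ≥0∞}
    (hg : Measurable g) (hu : Measurable u) :
    (∫⁻ x, g x * u x ∂μ) ^ 2 ≤ 2 * ((∫⁻ x, g x ∂μ) * ∫⁻ x, g x * u x ^ 2 ∂μ) := by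
  have hmul (s t : ℝ≥0∞) : s * t ≤ s ^ 2 + t ^ 2 := by
    rcases le_total s t with h | h
    · calc s * t ≤ t * t := by gcongr
        _ ≤ s ^ 2 + t ^ 2 := by rw [← sq]; exact le_add_self
    · calc s * t ≤ s * s := by gcongr
        _ ≤ s ^ 2 + t ^ 2 := by rw [← sq]; exact le_self_add
  calc (∫⁻ x, g x * u x ∂μ) ^ 2
      = ∫⁻ x, ∫⁻ y, g x * u x * (g y * u y) ∂μ ∂μ := by
        rw [sq, ← lintegral_mul_const _ (by fun_prop)]
        exact lintegral_congr fun x => (lintegral_const_mul _ (by fun_prop)).symm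
    _ ≤ ∫⁻ x, ∫⁻ y, g x * u x ^ 2 * g y + g x * (g y * u y ^ 2) ∂μ ∂μ := by
        refine lintegral_mono fun x => lintegral_mono fun y => ?_
        calc g x * u x * (g y * u y) = g x * g y * (u x * u y) := by ring
          _ ≤ g x * g y * (u x ^ 2 + u y ^ 2) := by gcongr; exact hmul _ _
          _ = g x * u x ^ 2 * g y + g x * (g y * u y ^ 2) := by ring
    _ = ∫⁻ x, g x * u x ^ 2 * (∫⁻ y, g y ∂μ) + g x * ∫⁻ y, g y * u y ^ 2 ∂μ ∂μ := by
        refine lintegral_congr fun x => ?_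
        rw [lintegral_add_left (by fun_prop), lintegral_const_mul _ (by fun_prop),
          lintegral_const_mul _ (by fun_prop)]
    _ = 2 * ((∫⁻ x, g x ∂μ) * ∫⁻ x, g x * u x ^ 2 ∂μ) := by
        rw [lintegral_add_left (by fun_prop), lintegral_mul_const _ (by fun_prop),
          lintegral_mul_const _ (by fun_prop)]
        ring

section Energy

variable {V : Type*} [NormedAddCommGroup V] [MeasurableSpace V] [BorelSpace V]
  [InnerProductSpace ℝ V] [FiniteDimensional ℝ V]

/-- Smoothing with a Gaussian kernel preserves square-integrability. -/
lemma lintegral_sq_smoothing_lt_top {a : ℝ} (ha : 0 < a) {u : V → ℝ≥0∞} (hu : Measurable u)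
    (h : ∫⁻ x, u x ^ 2 < ⊤) :
    ∫⁻ z, (∫⁻ x, gaussKernel a x z * u x) ^ 2 < ⊤ := by
  set C := ENNReal.ofReal ((Real.pi / a) ^ (Module.finrank ℝ V / 2 : ℝ))
  calc ∫⁻ z, (∫⁻ x, gaussKernel a x z * u x) ^ 2
      ≤ ∫⁻ z, 2 * (C * ∫⁻ x, gaussKernel a x z * u x ^ 2) := by
        refine lintegral_mono fun z => ?_
        have := sq_lintegral_mul_le (μ := volume) (g := fun x => gaussKernel a x z)
          (by fun_prop) hu
        rwa [lintegral_gaussKernel ha] at this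
    _ = 2 * (C * ∫⁻ z, ∫⁻ x, gaussKernel a x z * u x ^ 2) := by
        rw [lintegral_const_mul' _ _ (by simp), lintegral_const_mul' _ _ ENNReal.ofReal_ne_top]
    _ = 2 * (C * ∫⁻ x, ∫⁻ z, gaussKernel a x z * u x ^ 2) := by
        rw [lintegral_lintegral_swap (Measurable.aemeasurable _)]
        simp only [Function.uncurry_def]
        fun_prop
    _ = 2 * (C * (C * ∫⁻ x, u x ^ 2)) := by
        rw [← lintegral_const_mul' C (fun x => u x ^ 2) ENNReal.ofReal_ne_top]
        congr 2
        refine lintegral_congr fun x => ?_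
        simp_rw [gaussKernel_comm a x]
        rw [lintegral_mul_const _ (by fun_prop), lintegral_gaussKernel ha]
    _ < ⊤ := ENNReal.mul_lt_top (by simp) (ENNReal.mul_lt_top ENNReal.ofReal_lt_top
        (ENNReal.mul_lt_top ENNReal.ofReal_lt_top h))

/-- Halving the scale parameter preserves finiteness of the Gaussian energy. -/
lemma gaussEnergy_half_lt_top {a : ℝ} (ha : 0 < a) (μ : Measure V) [SFinite μ]
    (h : ∫⁻ y, ∫⁻ z, gaussKernel a y z ∂μ ∂μ < ⊤) :
    ∫⁻ y, ∫⁻ z, gaussKernel (a / 2) y z ∂μ ∂μ < ⊤ := by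
  have h1 : ∫⁻ x, (∫⁻ y, gaussKernel (2 * a) x y ∂μ) ^ 2 < ⊤ := by
    rw [lintegral_potential_sq (by positivity), mul_div_cancel_left₀ a two_ne_zero]
    exact ENNReal.mul_lt_top ENNReal.ofReal_lt_top h
  have h2 := lintegral_sq_smoothing_lt_top (a := 2 * a) (by positivity)
    (u := fun x => ∫⁻ y, gaussKernel (2 * a) x y ∂μ) (by fun_prop) h1
  simp_rw [lintegral_gaussKernel_mul_potential (show 0 < 2 * a by positivity), mul_pow] at h2
  rw [lintegral_const_mul' _ _ (by simp), mul_div_cancel_left₀ a two_ne_zero,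
    lintegral_potential_sq ha, ← mul_assoc] at h2
  refine ENNReal.lt_top_of_mul_ne_top_right h2.ne ?_
  have hpos (b : ℝ) (hb : 0 < b) :
      ENNReal.ofReal ((Real.pi / b) ^ (Module.finrank ℝ V / 2 : ℝ)) ≠ 0 :=
    (ENNReal.ofReal_pos.2 (by positivity)).ne'
  exact mul_ne_zero (pow_ne_zero _ (hpos _ (by positivity))) (hpos _ (by positivity))

/-- Finiteness of the Gaussian energy of a measure does not depend on the scale. -/
lemma gaussEnergy_lt_top {a b : ℝ} (ha : 0 < a) (hb : 0 < b) (μ : Measure V) [SFinite μ]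
    (h : ∫⁻ y, ∫⁻ z, gaussKernel a y z ∂μ ∂μ < ⊤) :
    ∫⁻ y, ∫⁻ z, gaussKernel b y z ∂μ ∂μ < ⊤ := by
  have hn (n : ℕ) : ∫⁻ y, ∫⁻ z, gaussKernel (a / 2 ^ n) y z ∂μ ∂μ < ⊤ := by
    induction n with
    | zero => simpa using h
    | succ n ih =>
      rw [pow_succ, ← div_div]
      exact gaussEnergy_half_lt_top (by positivity) μ ih
  obtain ⟨n, hlt⟩ := pow_unbounded_of_one_lt (a / b) one_lt_two
  refine (lintegral_mono fun y => lintegral_mono fun z => gaussKernel_anti ?_ y z).trans_lt (hn n)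
  rw [div_lt_iff₀ hb] at hlt
  rw [div_le_iff₀ (by positivity), mul_comm]
  exact hlt.le

end Energy

lemma heatContentENN_eq (m : ℕ) (D : Set (EuclideanSpace ℝ (Fin m))) {t : ℝ} (ht : 0 < t) :
    heatContentENN m D t = ENNReal.ofReal ((4 * Real.pi * t) ^ (-(m : ℝ) / 2)) *
      ∫⁻ x in D, ∫⁻ y in D, gaussKernel (1 / (4 * t)) x y := by
  unfold heatContentENN
  rw [← lintegral_const_mul' _ _ ENNReal.ofReal_ne_top]
  refine lintegral_congr fun x => ?_
  rw [← lintegral_const_mul' _ _ ENNReal.ofReal_ne_top]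
  refine lintegral_congr fun y => ?_
  rw [heatKernel, gaussKernel, ENNReal.ofReal_mul (by positivity), dist_eq_norm]
  congr 3
  ring

theorem heatContent_finite_forall_of_finite_exists (m : ℕ) (D : Set (EuclideanSpace ℝ (Fin m)))
    (hD : IsOpen D) (h : ∃ t > (0 : ℝ), heatContentENN m D t < ⊤) :
    ∀ t > (0 : ℝ), heatContentENN m D t < ⊤ := by
  obtain ⟨s, hs, hfin⟩ := h
  intro t ht
  rw [heatContentENN_eq m D hs] at hfin
  rw [heatContentENN_eq m D ht]
  refine ENNReal.mul_lt_top ENNReal.ofReal_lt_top ?_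
  refine gaussEnergy_lt_top (a := 1 / (4 * s)) (by positivity) (by positivity) _ ?_
  exact ENNReal.lt_top_of_mul_ne_top_right hfin.ne (ENNReal.ofReal_pos.2 (by positivity)).ne'
end

section
/- Let D be an open set in ℝ^m with finite Lebesgue measure and let t > 0. Then d₁(m)·t^{−m/2}·∫_D ν_D(x;4(mt)^{1/2}) dx ≤ F_D(t) ≤ d₂(m)·t^{−m/2}·∫_D ν_D(x;4(mt)^{1/2}) dx, where d₁(m) = e^{−4m}(4π)^{−m/2} and d₂(m) = (1 − 2^{(m+2)/2} e^{−2m})^{−1}(4π)^{−m/2}. -/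
open MeasureTheory Metric Set
open scoped ENNReal

noncomputable def heatContent (m : ℕ) (D : Set (EuclideanSpace ℝ (Fin m))) (t : ℝ) : ℝ :=
  ∫ x in D, ∫ y in D, heatKernel m t x y

/-- The heat loss of `D` in `ℝ^m` at time `t`. -/
noncomputable def heatLoss (m : ℕ) (D : Set (EuclideanSpace ℝ (Fin m))) (t : ℝ) : ℝ :=
  (volume D).toReal - heatContent m D t

lemma heatKernel_nonneg (m : ℕ) {t : ℝ} (ht : 0 < t) (x y : EuclideanSpace ℝ (Fin m)) :
    0 ≤ heatKernel m t x y := by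
  unfold heatKernel
  positivity

lemma heatKernel_comm (m : ℕ) (t : ℝ) (x y : EuclideanSpace ℝ (Fin m)) :
    heatKernel m t x y = heatKernel m t y x := by
  simp only [heatKernel, dist_comm]

lemma measurable_heatKernel (m : ℕ) (t : ℝ) :
    Measurable fun q : EuclideanSpace ℝ (Fin m) × EuclideanSpace ℝ (Fin m) =>
      heatKernel m t q.1 q.2 := by
  unfold heatKernel
  exact Continuous.measurable (by fun_prop)

lemma measurable_ofReal_heatKernel {m : ℕ} {α : Type*} [MeasurableSpace α] (t : ℝ)
    {f g : α → EuclideanSpace ℝ (Fin m)} (hf : Measurable f) (hg : Measurable g) :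
    Measurable fun a => ENNReal.ofReal (heatKernel m t (f a) (g a)) :=
  ((measurable_heatKernel m t).comp (hf.prodMk hg)).ennreal_ofReal

lemma lintegral_heatKernel (m : ℕ) {t : ℝ} (ht : 0 < t) (x : EuclideanSpace ℝ (Fin m)) :
    ∫⁻ y, ENNReal.ofReal (heatKernel m t x y) = 1 := by
  have hb : 0 < 1 / (4 * t) := by positivity
  have hG := GaussianFourier.integral_rexp_neg_mul_sq_norm
    (V := EuclideanSpace ℝ (Fin m)) hb
  have hpos : 0 < 4 * Real.pi * t := by positivity
  have hne : ∫ v : EuclideanSpace ℝ (Fin m), Real.exp (-(1 / (4 * t)) * ‖v‖ ^ 2) ≠ 0 := by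
    rw [hG]; positivity
  have hint : Integrable fun v : EuclideanSpace ℝ (Fin m) =>
      Real.exp (-(1 / (4 * t)) * ‖v‖ ^ 2) := by
    by_contra h
    exact hne (integral_undef h)
  have hker : ∀ y, heatKernel m t x y =
      (4 * Real.pi * t) ^ (-(m : ℝ) / 2) * Real.exp (-(1 / (4 * t)) * ‖y - x‖ ^ 2) := by
    intro y
    rw [heatKernel, dist_comm, dist_eq_norm]
    congr 2
    ring
  have hint' : Integrable fun y => heatKernel m t x y := by
    simp_rw [hker]
    exact (hint.comp_sub_right x).const_mul _
  rw [← ofReal_integral_eq_lintegral_ofReal hint'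
    (Filter.Eventually.of_forall (heatKernel_nonneg m ht x))]
  simp_rw [hker]
  rw [integral_const_mul,
    integral_sub_right_eq_self (fun v => Real.exp (-(1 / (4 * t)) * ‖v‖ ^ 2)) x, hG,
    finrank_euclideanSpace_fin, show Real.pi / (1 / (4 * t)) = 4 * Real.pi * t by field_simp,
    ← Real.rpow_add hpos, neg_div, neg_add_cancel, Real.rpow_zero, ENNReal.ofReal_one]

lemma heatKernel_mul (m : ℕ) {t : ℝ} (ht : 0 < t) (x y z : EuclideanSpace ℝ (Fin m)) :
    heatKernel m t x z * heatKernel m t z y =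
      heatKernel m (2 * t) x y * heatKernel m (t / 2) (midpoint ℝ x y) z := by
  have hpar : dist x z ^ 2 + dist z y ^ 2 =
      dist x y ^ 2 / 2 + 2 * dist (midpoint ℝ x y) z ^ 2 := by
    have h := parallelogram_law_with_norm ℝ (x - z) (y - z)
    have h1 : (x - z) + (y - z) = (2 : ℝ) • (midpoint ℝ x y - z) := by
      rw [midpoint_eq_smul_add, smul_sub, smul_smul]
      norm_num
      rw [two_smul]
      abel
    rw [h1, norm_smul, sub_sub_sub_cancel_right] at h
    norm_num at h
    rw [dist_comm z y]
    simp only [dist_eq_norm]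
    linarith
  have hconst : (4 * Real.pi * t) ^ (-(m : ℝ) / 2) * (4 * Real.pi * t) ^ (-(m : ℝ) / 2) =
      (4 * Real.pi * (2 * t)) ^ (-(m : ℝ) / 2) * (4 * Real.pi * (t / 2)) ^ (-(m : ℝ) / 2) := by
    rw [← Real.mul_rpow (by positivity) (by positivity),
      ← Real.mul_rpow (by positivity) (by positivity)]
    congr 1
    ring
  have hexp : Real.exp (-dist x z ^ 2 / (4 * t)) * Real.exp (-dist z y ^ 2 / (4 * t)) =
      Real.exp (-dist x y ^ 2 / (4 * (2 * t))) *
        Real.exp (-dist (midpoint ℝ x y) z ^ 2 / (4 * (t / 2))) := by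
    rw [← Real.exp_add, ← Real.exp_add]
    congr 1
    field_simp
    linarith
  unfold heatKernel
  rw [mul_mul_mul_comm, hconst, hexp, mul_mul_mul_comm]

/-- The Chapman–Kolmogorov identity for the heat kernel. -/
lemma lintegral_heatKernel_mul (m : ℕ) {t : ℝ} (ht : 0 < t) (x y : EuclideanSpace ℝ (Fin m)) :
    ∫⁻ z, ENNReal.ofReal (heatKernel m t x z) * ENNReal.ofReal (heatKernel m t z y) =
      ENNReal.ofReal (heatKernel m (2 * t) x y) := by
  simp_rw [← ENNReal.ofReal_mul (heatKernel_nonneg m ht x _), heatKernel_mul m ht,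
    ENNReal.ofReal_mul (heatKernel_nonneg m (by positivity : 0 < 2 * t) x y)]
  rw [lintegral_const_mul' _ _ ENNReal.ofReal_ne_top,
    lintegral_heatKernel m (by positivity), mul_one]

/-- The heat flowing from `A` to `B` in time `t`. -/
noncomputable def heatFlow (m : ℕ) (t : ℝ) (A B : Set (EuclideanSpace ℝ (Fin m))) : ℝ≥0∞ :=
  ∫⁻ x in A, ∫⁻ y in B, ENNReal.ofReal (heatKernel m t x y)

lemma measurable_setLIntegral_heatKernel (m : ℕ) (t : ℝ) (B : Set (EuclideanSpace ℝ (Fin m))) :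
    Measurable fun x => ∫⁻ y in B, ENNReal.ofReal (heatKernel m t x y) :=
  (measurable_ofReal_heatKernel t measurable_fst measurable_snd).lintegral_prod_right'

lemma setLIntegral_heatKernel_le_one (m : ℕ) {t : ℝ} (ht : 0 < t)
    (x : EuclideanSpace ℝ (Fin m)) (B : Set (EuclideanSpace ℝ (Fin m))) :
    ∫⁻ y in B, ENNReal.ofReal (heatKernel m t x y) ≤ 1 :=
  (setLIntegral_le_lintegral _ _).trans (lintegral_heatKernel m ht x).le

lemma heatFlow_le_volume (m : ℕ) {t : ℝ} (ht : 0 < t) (A B : Set (EuclideanSpace ℝ (Fin m))) :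
    heatFlow m t A B ≤ volume A :=
  (lintegral_mono fun x => setLIntegral_heatKernel_le_one m ht x B).trans (by simp)

lemma heatFlow_self_add_compl (m : ℕ) {t : ℝ} (ht : 0 < t)
    {D : Set (EuclideanSpace ℝ (Fin m))} (hD : MeasurableSet D) :
    heatFlow m t D D + heatFlow m t D Dᶜ = volume D := by
  unfold heatFlow
  rw [← lintegral_add_left (measurable_setLIntegral_heatKernel m t D)]
  simp_rw [lintegral_add_compl _ hD, lintegral_heatKernel m ht]
  simp

lemma heatContent_eq_toReal_heatFlow (m : ℕ) {t : ℝ} (ht : 0 < t)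
    (D : Set (EuclideanSpace ℝ (Fin m))) :
    heatContent m D t = (heatFlow m t D D).toReal := by
  unfold heatContent heatFlow
  rw [← integral_toReal (measurable_setLIntegral_heatKernel m t D).aemeasurable
    (Filter.Eventually.of_forall fun x =>
      (setLIntegral_heatKernel_le_one m ht x D).trans_lt ENNReal.one_lt_top)]
  congr 1
  ext x
  exact integral_eq_lintegral_of_nonneg_ae
    (Filter.Eventually.of_forall (heatKernel_nonneg m ht x))
    ((measurable_heatKernel m t).comp (measurable_const.prodMk measurable_id)).aestronglyMeasurable

lemma heatLoss_eq_toReal_heatFlow (m : ℕ) {t : ℝ} (ht : 0 < t)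
    {D : Set (EuclideanSpace ℝ (Fin m))} (hD : MeasurableSet D) (hvol : volume D ≠ ⊤) :
    heatLoss m D t = (heatFlow m t D Dᶜ).toReal := by
  have hfin : ∀ B, heatFlow m t D B ≠ ⊤ := fun B =>
    ne_top_of_le_ne_top hvol (heatFlow_le_volume m ht D B)
  rw [heatLoss, heatContent_eq_toReal_heatFlow m ht, ← heatFlow_self_add_compl m ht hD,
    ENNReal.toReal_add (hfin _) (hfin _), add_sub_cancel_left]

lemma heatFlow_comm (m : ℕ) (t : ℝ) (A B : Set (EuclideanSpace ℝ (Fin m))) :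
    heatFlow m t A B = heatFlow m t B A := by
  unfold heatFlow
  rw [lintegral_lintegral_swap
    (measurable_ofReal_heatKernel t measurable_fst measurable_snd).aemeasurable]
  simp_rw [heatKernel_comm]

lemma lintegral_heatKernel_mul_le (m : ℕ) {t : ℝ} (ht : 0 < t)
    (A B C : Set (EuclideanSpace ℝ (Fin m))) :
    ∫⁻ x in A, ∫⁻ z in C, ∫⁻ y in B,
      ENNReal.ofReal (heatKernel m t x z) * ENNReal.ofReal (heatKernel m t z y) ≤
        heatFlow m t A C := by
  refine lintegral_mono fun x => lintegral_mono fun z => ?_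
  rw [lintegral_const_mul' _ _ ENNReal.ofReal_ne_top]
  exact mul_le_of_le_one_right' (setLIntegral_heatKernel_le_one m ht z B)

lemma heatFlow_compl_two_mul_le (m : ℕ) {t : ℝ} (ht : 0 < t)
    {D : Set (EuclideanSpace ℝ (Fin m))} (hD : MeasurableSet D) :
    heatFlow m (2 * t) D Dᶜ ≤ 2 * heatFlow m t D Dᶜ := by
  have hmeas : ∀ x : EuclideanSpace ℝ (Fin m), Measurable
      (fun q : EuclideanSpace ℝ (Fin m) × EuclideanSpace ℝ (Fin m) =>
        ENNReal.ofReal (heatKernel m t x q.1) * ENNReal.ofReal (heatKernel m t q.1 q.2)) :=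
    fun x => (measurable_ofReal_heatKernel t measurable_const measurable_fst).mul
      (measurable_ofReal_heatKernel t measurable_fst measurable_snd)
  have hmeas3 : Measurable (fun p : (EuclideanSpace ℝ (Fin m) × EuclideanSpace ℝ (Fin m)) ×
      EuclideanSpace ℝ (Fin m) =>
        ENNReal.ofReal (heatKernel m t p.1.1 p.1.2) *
          ENNReal.ofReal (heatKernel m t p.1.2 p.2)) :=
    (measurable_ofReal_heatKernel t (measurable_fst.comp measurable_fst)
      (measurable_snd.comp measurable_fst)).mul
      (measurable_ofReal_heatKernel t (measurable_snd.comp measurable_fst) measurable_snd)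
  have hmeas2 : Measurable
      (fun p : EuclideanSpace ℝ (Fin m) × EuclideanSpace ℝ (Fin m) => ∫⁻ y in Dᶜ,
        ENNReal.ofReal (heatKernel m t p.1 p.2) * ENNReal.ofReal (heatKernel m t p.2 y)) :=
    hmeas3.lintegral_prod_right'
  have hsplit : heatFlow m (2 * t) D Dᶜ =
      (∫⁻ x in D, ∫⁻ z in D, ∫⁻ y in Dᶜ,
        ENNReal.ofReal (heatKernel m t x z) * ENNReal.ofReal (heatKernel m t z y)) +
      ∫⁻ x in D, ∫⁻ z in Dᶜ, ∫⁻ y in Dᶜ,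
        ENNReal.ofReal (heatKernel m t x z) * ENNReal.ofReal (heatKernel m t z y) := by
    rw [← lintegral_add_left hmeas2.lintegral_prod_right']
    refine lintegral_congr fun x => ?_
    rw [lintegral_add_compl _ hD, lintegral_lintegral_swap (hmeas x).aemeasurable]
    exact lintegral_congr fun y => (lintegral_heatKernel_mul m ht x y).symm
  have hreturn : (∫⁻ x in D, ∫⁻ z in D, ∫⁻ y in Dᶜ,
      ENNReal.ofReal (heatKernel m t x z) * ENNReal.ofReal (heatKernel m t z y)) ≤
        heatFlow m t D Dᶜ := by
    rw [lintegral_lintegral_swap hmeas2.aemeasurable]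
    refine lintegral_mono fun z => ?_
    simp_rw [lintegral_const_mul' _ _ ENNReal.ofReal_ne_top]
    rw [lintegral_mul_const _ (measurable_ofReal_heatKernel _ measurable_id' measurable_const)]
    simp_rw [heatKernel_comm m t _ z]
    exact mul_le_of_le_one_left' (setLIntegral_heatKernel_le_one m ht z D)
  rw [hsplit, two_mul]
  exact add_le_add hreturn (lintegral_heatKernel_mul_le m ht D Dᶜ Dᶜ)

lemma heatKernel_le (m : ℕ) {t : ℝ} (ht : 0 < t) (x y : EuclideanSpace ℝ (Fin m)) :
    heatKernel m t x y ≤ (4 * Real.pi * t) ^ (-(m : ℝ) / 2) := by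
  refine mul_le_of_le_one_right (by positivity) (Real.exp_le_one_iff.2 ?_)
  exact div_nonpos_of_nonpos_of_nonneg (neg_nonpos.2 (sq_nonneg _)) (by positivity)

lemma le_heatKernel_of_dist_le (m : ℕ) {t R : ℝ} (ht : 0 < t) {x y : EuclideanSpace ℝ (Fin m)}
    (h : dist x y ≤ R) :
    (4 * Real.pi * t) ^ (-(m : ℝ) / 2) * Real.exp (-R ^ 2 / (4 * t)) ≤ heatKernel m t x y := by
  unfold heatKernel
  gcongr

lemma heatKernel_le_of_le_dist (m : ℕ) {t R : ℝ} (ht : 0 < t) (hR : 0 ≤ R)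
    {x y : EuclideanSpace ℝ (Fin m)} (h : R ≤ dist x y) :
    heatKernel m t x y ≤
      2 ^ ((m : ℝ) / 2) * Real.exp (-R ^ 2 / (8 * t)) * heatKernel m (2 * t) x y := by
  have hconst : (4 * Real.pi * t) ^ (-(m : ℝ) / 2) =
      2 ^ ((m : ℝ) / 2) * (4 * Real.pi * (2 * t)) ^ (-(m : ℝ) / 2) := by
    rw [show 4 * Real.pi * (2 * t) = 2 * (4 * Real.pi * t) by ring,
      Real.mul_rpow (y := 4 * Real.pi * t) zero_le_two (by positivity), ← mul_assoc, ← Real.rpow_add (by norm_num),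
      neg_div, add_neg_cancel, Real.rpow_zero, one_mul]
  have hexp : Real.exp (-dist x y ^ 2 / (4 * t)) ≤
      Real.exp (-R ^ 2 / (8 * t)) * Real.exp (-dist x y ^ 2 / (4 * (2 * t))) := by
    rw [← Real.exp_add, Real.exp_le_exp]
    have h2 : R ^ 2 ≤ dist x y ^ 2 := by gcongr
    have : -dist x y ^ 2 / (4 * t) = -dist x y ^ 2 / (8 * t) + -dist x y ^ 2 / (4 * (2 * t)) := by
      field_simp
      ring
    rw [this]
    gcongr
  unfold heatKernel
  rw [hconst]
  calc _ ≤ 2 ^ ((m : ℝ) / 2) * (4 * Real.pi * (2 * t)) ^ (-(m : ℝ) / 2) *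
        (Real.exp (-R ^ 2 / (8 * t)) * Real.exp (-dist x y ^ 2 / (4 * (2 * t)))) := by gcongr
    _ = _ := by ring

lemma mul_lintegral_volume_ball_inter_le_heatFlow (m : ℕ) {t : ℝ} (ht : 0 < t) (R : ℝ)
    (D B : Set (EuclideanSpace ℝ (Fin m))) :
    ENNReal.ofReal ((4 * Real.pi * t) ^ (-(m : ℝ) / 2) * Real.exp (-R ^ 2 / (4 * t))) *
      ∫⁻ x in D, volume (ball x R ∩ B) ≤ heatFlow m t D B := by
  rw [← lintegral_const_mul' _ _ ENNReal.ofReal_ne_top]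
  refine lintegral_mono fun x => ?_
  calc _ = ∫⁻ _ in ball x R ∩ B, ENNReal.ofReal
          ((4 * Real.pi * t) ^ (-(m : ℝ) / 2) * Real.exp (-R ^ 2 / (4 * t))) := by simp
    _ = ∫⁻ _ in ball x R, ENNReal.ofReal ((4 * Real.pi * t) ^ (-(m : ℝ) / 2) *
          Real.exp (-R ^ 2 / (4 * t))) ∂(volume.restrict B) := by
        rw [Measure.restrict_restrict measurableSet_ball]
    _ ≤ ∫⁻ y in ball x R, ENNReal.ofReal (heatKernel m t x y) ∂(volume.restrict B) := by
        refine setLIntegral_mono' measurableSet_ball fun y hy => ENNReal.ofReal_le_ofReal ?_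
        exact le_heatKernel_of_dist_le m ht (mem_ball'.1 hy).le
    _ ≤ _ := setLIntegral_le_lintegral _ _

lemma heatFlow_le_add (m : ℕ) {t R : ℝ} (ht : 0 < t) (hR : 0 ≤ R)
    (D B : Set (EuclideanSpace ℝ (Fin m))) :
    heatFlow m t D B ≤
      ENNReal.ofReal (2 ^ ((m : ℝ) / 2) * Real.exp (-R ^ 2 / (8 * t))) * heatFlow m (2 * t) D B +
      ENNReal.ofReal ((4 * Real.pi * t) ^ (-(m : ℝ) / 2)) * ∫⁻ x in D, volume (ball x R ∩ B) := by
  unfold heatFlow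
  rw [← lintegral_const_mul' _ _ ENNReal.ofReal_ne_top,
    ← lintegral_const_mul' _ _ ENNReal.ofReal_ne_top,
    ← lintegral_add_left ((measurable_setLIntegral_heatKernel m (2 * t) B).const_mul _)]
  refine lintegral_mono fun x => ?_
  rw [← lintegral_add_compl _ (measurableSet_ball (x := x) (ε := R)), add_comm]
  refine add_le_add ?_ ?_
  · rw [← lintegral_const_mul' _ _ ENNReal.ofReal_ne_top]
    refine le_trans (setLIntegral_mono' measurableSet_ball.compl fun y hy => ?_)
      (setLIntegral_le_lintegral _ _)
    rw [← ENNReal.ofReal_mul (by positivity)]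
    refine ENNReal.ofReal_le_ofReal (heatKernel_le_of_le_dist m ht hR ?_)
    simpa [dist_comm] using hy
  · refine (lintegral_mono fun y => ENNReal.ofReal_le_ofReal (heatKernel_le m ht x y)).trans ?_
    simp [Measure.restrict_restrict measurableSet_ball]

lemma two_rpow_mul_exp_lt_one {m : ℕ} (hm : m ≠ 0) :
    (2 : ℝ) ^ (((m : ℝ) + 2) / 2) * Real.exp (-2 * m) < 1 := by
  have h1 : (1 : ℝ) ≤ m := by exact_mod_cast Nat.one_le_iff_ne_zero.2 hm
  rw [Real.rpow_def_of_pos (by norm_num), ← Real.exp_add, Real.exp_lt_one_iff]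
  nlinarith [Real.log_two_lt_d9]

theorem heatLoss_two_sided_bound (m : ℕ) (D : Set (EuclideanSpace ℝ (Fin m))) (hD : IsOpen D)
    (hvol : volume D < ⊤) (t : ℝ) (ht : 0 < t) :
    Real.exp (-4 * m) * (4 * Real.pi) ^ (-(m : ℝ) / 2) * t ^ (-(m : ℝ) / 2) *
        (∫⁻ x in D, volume (ball x (4 * Real.sqrt (m * t)) ∩ Dᶜ)).toReal ≤
      heatLoss m D t ∧
    heatLoss m D t ≤
      (1 - 2 ^ (((m : ℝ) + 2) / 2) * Real.exp (-2 * m))⁻¹ * (4 * Real.pi) ^ (-(m : ℝ) / 2) *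
        t ^ (-(m : ℝ) / 2) *
        (∫⁻ x in D, volume (ball x (4 * Real.sqrt (m * t)) ∩ Dᶜ)).toReal := by
  have hRsq : (4 * Real.sqrt (m * t)) ^ 2 = 16 * (m * t) := by
    rw [mul_pow, Real.sq_sqrt (by positivity)]
    norm_num
  have hlow : Real.exp (-(4 * Real.sqrt (m * t)) ^ 2 / (4 * t)) = Real.exp (-4 * m) := by
    rw [hRsq]
    congr 1
    field_simp
    ring
  have hhigh : Real.exp (-(4 * Real.sqrt (m * t)) ^ 2 / (8 * t)) = Real.exp (-2 * m) := by
    rw [hRsq]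
    congr 1
    field_simp
    ring
  have hk : (4 * Real.pi * t) ^ (-(m : ℝ) / 2) =
      (4 * Real.pi) ^ (-(m : ℝ) / 2) * t ^ (-(m : ℝ) / 2) :=
    Real.mul_rpow (by positivity) ht.le
  have hlower := mul_lintegral_volume_ball_inter_le_heatFlow m ht (4 * Real.sqrt (m * t)) D Dᶜ
  have hupper := heatFlow_le_add m ht (by positivity : 0 ≤ 4 * Real.sqrt (m * t)) D Dᶜ
  rw [heatLoss_eq_toReal_heatFlow m ht hD.measurableSet hvol.ne]
  have hF : heatFlow m t D Dᶜ ≠ ⊤ := ne_top_of_le_ne_top hvol.ne (heatFlow_le_volume m ht D Dᶜ)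
  rw [hlow] at hlower
  rw [hhigh] at hupper
  generalize hN : ∫⁻ x in D, volume (ball x (4 * Real.sqrt (m * t)) ∩ Dᶜ) = N at *
  have hNfin : N ≠ ⊤ := by
    rintro rfl
    rw [ENNReal.mul_top (ENNReal.ofReal_pos.2 (by positivity)).ne'] at hlower
    exact hF (top_le_iff.1 hlower)
  constructor
  · have h := ENNReal.toReal_mono hF hlower
    rw [ENNReal.toReal_mul, ENNReal.toReal_ofReal (by positivity), hk] at h
    linarith
  · rcases eq_or_ne m 0 with rfl | hm
    · have hflow : heatFlow 0 t D Dᶜ = 0 := by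
        rcases D.eq_empty_or_nonempty with rfl | hne
        · simp [heatFlow]
        · simp [heatFlow, Subsingleton.eq_univ_of_nonempty hne]
      have hN0 : N = 0 := by
        rw [hflow, nonpos_iff_eq_zero] at hlower
        exact (mul_eq_zero.1 hlower).resolve_left (ENNReal.ofReal_pos.2 (by positivity)).ne'
      simp [hflow, hN0]
    · have h := hupper.trans (add_le_add_left
        (mul_le_mul_right (heatFlow_compl_two_mul_le m ht hD.measurableSet) _) _)
      have h := ENNReal.toReal_mono (by finiteness) h
      rw [ENNReal.toReal_add (by finiteness) (by finiteness), ENNReal.toReal_mul,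
        ENNReal.toReal_mul, ENNReal.toReal_mul, ENNReal.toReal_ofReal (by positivity),
        ENNReal.toReal_ofReal (by positivity), ENNReal.toReal_ofNat] at h
      have h2 : (2 : ℝ) ^ (((m : ℝ) + 2) / 2) = 2 ^ ((m : ℝ) / 2) * 2 := by
        rw [add_div, Real.rpow_add (by norm_num)]
        norm_num
      have hpos := sub_pos.2 (two_rpow_mul_exp_lt_one hm)
      rw [mul_assoc, mul_assoc, ← mul_assoc (_ ^ _), ← hk, le_inv_mul_iff₀ hpos, h2]
      linarith
end

section
/- Let D be an open subset of ℝ^m, m ≥ 2, with R-smooth boundary ∂D and finite Lebesgue measure |D|. Then the set of connected components of D is finite, with cardinality at most ω_m^{−1}·R^{−m}·|D|, where ω_m is the volume of the unit ball in ℝ^m. -/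
open MeasureTheory Metric Set

/-- `D` has `R`-smooth boundary: at every boundary point there are interior and
exterior tangent open balls of radius `R` whose closures meet exactly at that point. -/
def HasRSmoothBoundary (m : ℕ) (D : Set (EuclideanSpace ℝ (Fin m))) (R : ℝ) : Prop :=
  ∀ x₀ ∈ frontier D, ∃ c₁ c₂ : EuclideanSpace ℝ (Fin m),
    ball c₁ R ⊆ D ∧ ball c₂ R ⊆ (closure D)ᶜ ∧
    closure (ball c₁ R) ∩ closure (ball c₂ R) = {x₀}

/-- If two balls touching `x₀` are both disjoint from a third ball touching `x₀`, then they meet. -/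
theorem not_disjoint_ball_of_disjoint_ball {E : Type*} [NormedAddCommGroup E] [NormedSpace ℝ E]
    [StrictConvexSpace ℝ E] {x₀ x y z : E} {d r s : ℝ} (hd : 0 < d) (hr : 0 < r) (hs : 0 < s)
    (hx : dist x x₀ ≤ d) (hy : dist y x₀ ≤ r) (hz : dist z x₀ ≤ s)
    (hxz : Disjoint (ball x d) (ball z s)) (hyz : Disjoint (ball y r) (ball z s)) :
    ¬ Disjoint (ball x d) (ball y r) := by
  rw [disjoint_ball_ball_iff hd hs] at hxz
  rw [disjoint_ball_ball_iff hr hs] at hyz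
  rw [disjoint_ball_ball_iff hd hr, not_le]
  have hxz' := dist_triangle_right x z x₀
  have hyz' := dist_triangle_right y z x₀
  have h₁ : SameRay ℝ (x - x₀) (x₀ - z) := by
    rw [sameRay_iff_norm_add, sub_add_sub_cancel, ← dist_eq_norm, ← dist_eq_norm,
      ← dist_eq_norm, dist_comm x₀ z]
    linarith
  have h₂ : SameRay ℝ (y - x₀) (x₀ - z) := by
    rw [sameRay_iff_norm_add, sub_add_sub_cancel, ← dist_eq_norm, ← dist_eq_norm,
      ← dist_eq_norm, dist_comm x₀ z]
    linarith
  have hne : x₀ - z ≠ 0 := by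
    rw [sub_ne_zero, ← dist_pos, dist_comm]
    linarith
  have h := (h₁.trans h₂.symm fun h => absurd h hne).norm_sub
  rw [sub_sub_sub_cancel_right, ← dist_eq_norm, ← dist_eq_norm, ← dist_eq_norm] at h
  rw [h, abs_lt]
  constructor <;> linarith

/-- Components of an open set with `R`-smooth boundary contain a ball of radius `R`. -/
theorem HasRSmoothBoundary.exists_ball_subset_connectedComponentIn {m : ℕ}
    {D : Set (EuclideanSpace ℝ (Fin m))} {R : ℝ} (hsmooth : HasRSmoothBoundary m D R)
    (hD : IsOpen D) (hR : 0 < R) {x : EuclideanSpace ℝ (Fin m)} (hx : x ∈ D) :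
    ∃ c, ball c R ⊆ connectedComponentIn D x := by
  set C := connectedComponentIn D x with hC
  have hCo : IsOpen C := hD.connectedComponentIn
  have hxC : x ∈ C := mem_connectedComponentIn hx
  have hCD : C ⊆ D := connectedComponentIn_subset D x
  rcases Set.eq_empty_or_nonempty Cᶜ with hempty | hne
  · exact ⟨0, by rw [compl_empty_iff.1 hempty]; exact subset_univ _⟩
  obtain ⟨x₀, hx₀, hdist⟩ := hCo.isClosed_compl.exists_infDist_eq_dist hne x
  have hd : 0 < dist x x₀ := dist_pos.2 fun h => hx₀ (h ▸ hxC)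
  have hball : ball x (dist x x₀) ⊆ C := by
    rw [← hdist, ← disjoint_compl_right_iff_subset]
    exact disjoint_ball_infDist
  have hx₀C : x₀ ∈ closure C := by
    refine closure_mono hball ?_
    rw [closure_ball x hd.ne', mem_closedBall, dist_comm]
  have hx₀D : x₀ ∉ D := fun h => by
    obtain ⟨y, hy, hyC⟩ := mem_closure_iff.1 hx₀C _ (hD.connectedComponentIn (x := x₀))
      (mem_connectedComponentIn h)
    apply hx₀
    have := (connectedComponentIn_eq hy).trans (connectedComponentIn_eq hyC).symm
    rw [hC, ← this]
    exact mem_connectedComponentIn h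
  obtain ⟨c₁, c₂, h₁, h₂, h⟩ := hsmooth x₀ ⟨closure_mono hCD hx₀C, by rwa [hD.interior_eq]⟩
  have hmem : x₀ ∈ closure (ball c₁ R) ∩ closure (ball c₂ R) := h ▸ mem_singleton x₀
  rw [closure_ball _ hR.ne', closure_ball _ hR.ne', mem_inter_iff, mem_closedBall',
    mem_closedBall'] at hmem
  have hdisj : Disjoint D (ball c₂ R) :=
    (disjoint_compl_right.mono_left subset_closure).mono_right h₂
  obtain ⟨y, hyx, hy⟩ := Set.not_disjoint_iff.1 <|
    not_disjoint_ball_of_disjoint_ball hd hR hR le_rfl hmem.1 hmem.2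
      (hdisj.mono_left (hball.trans hCD)) (hdisj.mono_left h₁)
  refine ⟨c₁, ?_⟩
  rw [hC, connectedComponentIn_eq (hball hyx)]
  exact (convex_ball c₁ R).isPreconnected.subset_connectedComponentIn hy h₁

theorem finitely_many_components (m : ℕ) (hm : 2 ≤ m)
    (D : Set (EuclideanSpace ℝ (Fin m))) (hD : IsOpen D)
    (R : ℝ) (hR : 0 < R) (hsmooth : HasRSmoothBoundary m D R) (hvol : volume D < ⊤) :
    {C : Set (EuclideanSpace ℝ (Fin m)) | ∃ x ∈ D, C = connectedComponentIn D x}.Finite ∧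
      ({C : Set (EuclideanSpace ℝ (Fin m)) |
          ∃ x ∈ D, C = connectedComponentIn D x}.ncard : ℝ) ≤
        ((volume (ball (0 : EuclideanSpace ℝ (Fin m)) 1)).toReal)⁻¹ * R ^ (-(m : ℤ)) *
          (volume D).toReal := by
  set S := {C : Set (EuclideanSpace ℝ (Fin m)) | ∃ x ∈ D, C = connectedComponentIn D x}
  set ω := volume (ball (0 : EuclideanSpace ℝ (Fin m)) 1)
  have hω0 : 0 < ω := measure_ball_pos _ _ one_pos
  have hωtop : ω < ⊤ := measure_ball_lt_top
  have hRm : 0 < R ^ m := pow_pos hR m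
  have hmeas : ∀ C : S, MeasurableSet (C : Set (EuclideanSpace ℝ (Fin m))) := by
    rintro ⟨C, x, hx, rfl⟩
    exact hD.connectedComponentIn.measurableSet
  have hvolume : ∀ C : S,
      ENNReal.ofReal (R ^ m) * ω ≤ volume (C : Set (EuclideanSpace ℝ (Fin m))) := by
    rintro ⟨C, x, hx, rfl⟩
    obtain ⟨c, hc⟩ := hsmooth.exists_ball_subset_connectedComponentIn hD hR hx
    refine le_trans (le_of_eq ?_) (measure_mono hc)
    rw [Measure.addHaar_ball_of_pos volume c hR, finrank_euclideanSpace_fin]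
  have hdisj : Pairwise (Function.onFun Disjoint
      (fun C : S => (C : Set (EuclideanSpace ℝ (Fin m))))) := by
    rintro ⟨C, x, hx, rfl⟩ ⟨C', x', hx', rfl⟩ hne
    refine Set.disjoint_left.2 fun y hy hy' => hne (Subtype.ext ?_)
    exact (connectedComponentIn_eq hy).trans (connectedComponentIn_eq hy').symm
  have hsub : (⋃ C : S, (C : Set (EuclideanSpace ℝ (Fin m)))) ⊆ D := by
    refine iUnion_subset ?_
    rintro ⟨C, x, hx, rfl⟩
    exact connectedComponentIn_subset D x
  have hpos : 0 < ENNReal.ofReal (R ^ m) * ω :=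
    ENNReal.mul_pos (ENNReal.ofReal_pos.2 hRm).ne' hω0.ne'
  have hfin : S.Finite := by
    have h := Measure.finite_const_le_meas_of_disjoint_iUnion volume hpos hmeas hdisj
      (measure_mono hsub |>.trans_lt hvol).ne
    rw [show {C : S | ENNReal.ofReal (R ^ m) * ω ≤ volume (C : Set (EuclideanSpace ℝ (Fin m)))} =
        univ from
      eq_univ_of_forall hvolume] at h
    exact Set.finite_coe_iff.1 (Set.finite_univ_iff.1 h)
  refine ⟨hfin, ?_⟩
  have := hfin.fintype
  have hsum : (S.ncard : ENNReal) * (ENNReal.ofReal (R ^ m) * ω) ≤ volume D := by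
    calc (S.ncard : ENNReal) * (ENNReal.ofReal (R ^ m) * ω)
        = ∑ _C : S, ENNReal.ofReal (R ^ m) * ω := by
          rw [Finset.sum_const, Finset.card_univ, nsmul_eq_mul, ← Nat.card_eq_fintype_card,
            Nat.card_coe_set_eq]
      _ ≤ ∑ C : S, volume (C : Set (EuclideanSpace ℝ (Fin m))) :=
          Finset.sum_le_sum fun C _ => hvolume C
      _ = volume (⋃ C : S, (C : Set (EuclideanSpace ℝ (Fin m)))) := by
          rw [measure_iUnion hdisj hmeas, tsum_fintype]
      _ ≤ volume D := measure_mono hsub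
  have hreal := ENNReal.toReal_mono hvol.ne hsum
  rw [ENNReal.toReal_mul, ENNReal.toReal_mul, ENNReal.toReal_natCast,
    ENNReal.toReal_ofReal hRm.le] at hreal
  have hω' : 0 < ω.toReal := ENNReal.toReal_pos hω0.ne' hωtop.ne
  rw [zpow_neg, zpow_natCast, ← mul_inv, inv_mul_eq_div, le_div_iff₀ (by positivity),
    mul_comm ω.toReal]
  exact hreal
end

section
/- Let D be an open subset of ℝ^m, m ≥ 2, with R-smooth boundary ∂D and finite Lebesgue measure |D|, and let D^i be a connected component of D. Then D^i is bounded and diam(D^i) ≤ (|D^i| + (2ω_{m−1} − ω_m)R^m)/(ω_{m−1}·R^{m−1}), where diam(D^i) = sup{|x−y| : x,y ∈ D^i}, ω_m is the volume of the unit ball in ℝ^m, and ω_{m−1} is the volume of the unit ball in ℝ^{m−1}. -/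
open MeasureTheory Metric Set

open Filter Topology

/-- Rolling a ball of radius `R` inside `D`: each point `x` of `D` at distance `d` from the
complement is within `max (R - d) 0` of the centre of a ball of radius `R` contained in `D`. -/
lemma HasRSmoothBoundary.exists_inner_center {m : ℕ} {D : Set (EuclideanSpace ℝ (Fin m))}
    (hD : IsOpen D) {R : ℝ} (hR : 0 < R) (h : HasRSmoothBoundary m D R) (hne : Dᶜ.Nonempty)
    {x : EuclideanSpace ℝ (Fin m)} (hx : x ∈ D) :
    ∃ c, R ≤ infDist c Dᶜ ∧ dist x c ≤ max (R - infDist x Dᶜ) 0 := by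
  have hd : 0 < infDist x Dᶜ :=
    (hD.isClosed_compl.notMem_iff_infDist_pos hne).1 (fun h => h hx)
  rcases le_or_gt R (infDist x Dᶜ) with hRd | hdR
  · exact ⟨x, hRd, by simp⟩
  obtain ⟨y, hy, hxy⟩ := hD.isClosed_compl.exists_infDist_eq_dist hne x
  set d := infDist x Dᶜ with hd_def
  have hball : ball x d ⊆ D := fun z hz => by
    by_contra hzD
    have := infDist_le_dist_of_mem (x := x) (show z ∈ Dᶜ from hzD)
    rw [mem_ball, dist_comm] at hz
    linarith
  have hyfr : y ∈ frontier D := by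
    rw [hD.frontier_eq]
    refine ⟨closure_mono hball ?_, hy⟩
    rw [closure_ball x hd.ne', mem_closedBall, dist_comm, hxy]
  obtain ⟨c₁, c₂, h₁, h₂, h₁₂⟩ := h y hyfr
  have hyc : y ∈ closure (ball c₁ R) ∩ closure (ball c₂ R) := by rw [h₁₂]; rfl
  rw [closure_ball c₁ hR.ne', closure_ball c₂ hR.ne'] at hyc
  have hy₁ : dist y c₁ ≤ R := hyc.1
  have hy₂ : dist y c₂ ≤ R := hyc.2
  have disj {s : Set (EuclideanSpace ℝ (Fin m))} (hs : s ⊆ D) : Disjoint s (ball c₂ R) :=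
    Set.disjoint_of_subset (hs.trans subset_closure) h₂ disjoint_compl_right
  have hc₁₂ := (disjoint_ball_ball_iff hR hR).1 (disj h₁)
  have hxc₂ := (disjoint_ball_ball_iff hd hR).1 (disj hball)
  have t₁ := dist_triangle c₁ y c₂
  have t₂ := dist_triangle x y c₂
  rw [dist_comm c₁ y] at t₁
  have hyc₁ : dist y c₁ = R := by linarith
  have hyc₂ : dist y c₂ = R := by linarith
  have hmid : y = midpoint ℝ c₁ c₂ :=
    eq_midpoint_of_dist_eq_half (by rw [dist_comm]; linarith) (by linarith)
  have hline : y = AffineMap.lineMap c₂ x (R / (R + d)) := by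
    have hc : dist c₂ x = R + d := by rw [dist_comm]; linarith
    apply eq_lineMap_of_dist_eq_mul_of_dist_eq_mul
    · rw [hc, dist_comm, hyc₂]; field_simp
    · rw [hc, dist_comm, ← hxy]; field_simp; ring
  have hc₁ : c₁ - y = y - c₂ := by
    rw [midpoint_eq_smul_add] at hmid
    have : (2 : ℝ) • y = c₁ + c₂ := by rw [hmid, smul_smul]; norm_num
    rw [two_smul] at this
    rw [sub_eq_sub_iff_add_eq_add, ← this]
  have hx₂ : x - c₂ = ((R + d) / R) • (y - c₂) := by
    have : y - c₂ = (R / (R + d)) • (x - c₂) := by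
      conv_lhs => rw [hline]
      simp [AffineMap.lineMap_apply]
    rw [this, smul_smul, div_mul_div_cancel₀ hR.ne', div_self (by positivity), one_smul]
  refine ⟨c₁, ?_, ?_⟩
  · refine (le_infDist hne).2 fun z hz => ?_
    by_contra! hlt
    exact hz (h₁ (by rwa [mem_ball, dist_comm]))
  · have : x - c₁ = -((R - d) / R) • (y - c₂) := by
      have e : x - c₁ = (x - c₂) - ((c₁ - y) + (y - c₂)) := by abel
      rw [e, hx₂, hc₁, ← two_smul ℝ, ← sub_smul]
      congr 1
      field_simp
      ring
    rw [dist_eq_norm, this, norm_smul, norm_neg, ← dist_eq_norm, hyc₂, Real.norm_eq_abs,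
      abs_of_pos (div_pos (by linarith) hR), div_mul_cancel₀ _ hR.ne']
    exact le_max_left _ _

/-- The centre given by `HasRSmoothBoundary.exists_inner_center` is unique. -/
lemma inner_center_unique {m : ℕ} {D : Set (EuclideanSpace ℝ (Fin m))}
    (hD : IsOpen D) {R : ℝ} (hR : 0 < R) (hne : Dᶜ.Nonempty)
    {x c c' : EuclideanSpace ℝ (Fin m)} (hx : x ∈ D)
    (hc : R ≤ infDist c Dᶜ) (hxc : dist x c ≤ max (R - infDist x Dᶜ) 0)
    (hc' : R ≤ infDist c' Dᶜ) (hxc' : dist x c' ≤ max (R - infDist x Dᶜ) 0) : c = c' := by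
  have hd : 0 < infDist x Dᶜ :=
    (hD.isClosed_compl.notMem_iff_infDist_pos hne).1 (fun h => h hx)
  rcases le_or_gt R (infDist x Dᶜ) with hRd | hdR
  · rw [max_eq_right (by linarith)] at hxc hxc'
    rw [← dist_le_zero.1 hxc, ← dist_le_zero.1 hxc']
  obtain ⟨y, hy, hxy⟩ := hD.isClosed_compl.exists_infDist_eq_dist hne x
  set d := infDist x Dᶜ
  rw [max_eq_left (by linarith)] at hxc hxc'
  have key {c : EuclideanSpace ℝ (Fin m)} (hc : R ≤ infDist c Dᶜ) (hxc : dist x c ≤ R - d) :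
      x = AffineMap.lineMap y c (d / R) := by
    have h₁ := hc.trans (infDist_le_dist_of_mem hy)
    have h₂ := dist_triangle c x y
    rw [dist_comm c x] at h₂
    have hyc : dist y c = R := by rw [dist_comm]; linarith
    apply eq_lineMap_of_dist_eq_mul_of_dist_eq_mul
    · rw [hyc, dist_comm, ← hxy, div_mul_cancel₀ _ hR.ne']
    · rw [hyc, sub_mul, div_mul_cancel₀ _ hR.ne']
      linarith
  have h := (key hc hxc).symm.trans (key hc' hxc')
  simpa [AffineMap.lineMap_apply, hd.ne', hR.ne'] using h

/-- Moving each point of `D` to the centre of an inner ball of radius `R` containing it can be done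
continuously. -/
lemma HasRSmoothBoundary.exists_continuousOn_retraction {m : ℕ}
    {D : Set (EuclideanSpace ℝ (Fin m))} (hD : IsOpen D) {R : ℝ} (hR : 0 < R)
    (h : HasRSmoothBoundary m D R) (hne : Dᶜ.Nonempty) :
    ∃ r : EuclideanSpace ℝ (Fin m) → EuclideanSpace ℝ (Fin m), ContinuousOn r D ∧
      ∀ x ∈ D, dist x (r x) < R ∧ ball (r x) R ⊆ D := by
  have hex : ∀ x, ∃ c, x ∈ D → R ≤ infDist c Dᶜ ∧ dist x c ≤ max (R - infDist x Dᶜ) 0 := by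
    intro x
    by_cases hx : x ∈ D
    · obtain ⟨c, hc⟩ := h.exists_inner_center hD hR hne hx
      exact ⟨c, fun _ => hc⟩
    · exact ⟨x, fun hx' => absurd hx' hx⟩
  choose r hr using hex
  have hlt : ∀ x ∈ D, dist x (r x) < R := fun x hx => by
    have hd : 0 < infDist x Dᶜ :=
      (hD.isClosed_compl.notMem_iff_infDist_pos hne).1 (fun h => h hx)
    exact (hr x hx).2.trans_lt (max_lt (by linarith) hR)
  refine ⟨r, fun x hx => ?_, fun x hx => ⟨hlt x hx, fun z hz => ?_⟩⟩
  · refine tendsto_of_subseq_tendsto fun u hu => ?_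
    rw [tendsto_nhdsWithin_iff] at hu
    obtain ⟨hu, huD⟩ := hu
    obtain ⟨N, hN⟩ := eventually_atTop.1
      (huD.and (hu (ball_mem_nhds x one_pos)))
    obtain ⟨c, -, φ, hφ, hc⟩ := tendsto_subseq_of_bounded (isBounded_ball (x := x) (r := R + 1))
      (x := fun n => r (u (n + N))) (fun n => by
        have h₁ := hlt _ (hN (n + N) (by omega)).1
        have h₂ : dist (u (n + N)) x < 1 := (hN (n + N) (by omega)).2
        have h₃ := dist_triangle_left (r (u (n + N))) x (u (n + N))
        rw [mem_ball]
        linarith)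
    have hv : Tendsto (fun n => u (φ n + N)) atTop (𝓝 x) :=
      hu.comp ((tendsto_add_atTop_nat N).comp hφ.tendsto_atTop)
    have hvr := fun n => hr (u (φ n + N)) (hN _ (by omega)).1
    have hinf := continuous_infDist_pt (Dᶜ)
    have hcx : c = r x := by
      refine inner_center_unique hD hR hne hx ?_ ?_ (hr x hx).1 (hr x hx).2
      · exact ge_of_tendsto' ((hinf.tendsto c).comp hc) fun n => (hvr n).1
      · exact le_of_tendsto_of_tendsto' (hv.dist hc)
          ((tendsto_const_nhds.sub ((hinf.tendsto x).comp hv)).max tendsto_const_nhds)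
          fun n => (hvr n).2
    exact ⟨fun n => φ n + N, hcx ▸ hc⟩
  · by_contra hzD
    have := (hr x hx).1.trans (infDist_le_dist_of_mem (show z ∈ Dᶜ from hzD))
    rw [mem_ball, dist_comm] at hz
    linarith

/-- The coordinate along a unit vector `e`, realised as the first factor of a measure-preserving
splitting of `ℝⁿ⁺¹` into a line and its orthogonal hyperplane. -/
lemma exists_measurePreserving_splitting {n : ℕ} (e : EuclideanSpace ℝ (Fin (n + 1)))
    (he : ‖e‖ = 1) :
    ∃ T : EuclideanSpace ℝ (Fin (n + 1)) ≃ᵐ ℝ × EuclideanSpace ℝ (Fin n),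
      MeasurePreserving T volume volume ∧ (∀ x, (T x).1 = inner ℝ e x) ∧
      ∀ x y, dist x y ^ 2 = ((T x).1 - (T y).1) ^ 2 + dist (T x).2 (T y).2 ^ 2 := by
  obtain ⟨b, hb⟩ := Orthonormal.exists_orthonormalBasis_extension_of_card_eq (𝕜 := ℝ)
    (E := EuclideanSpace ℝ (Fin (n + 1))) (ι := Fin (n + 1)) (by simp) (v := fun _ => e)
    (s := {0}) (by
      refine ⟨fun _ => he, fun i j hij => absurd (Subsingleton.elim i j) hij⟩)
  have hb0 : b 0 = e := hb 0 rfl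
  let T₁ := b.repr.toHomeomorph.toMeasurableEquiv
  let T₂ := (MeasurableEquiv.toLp 2 (Fin (n + 1) → ℝ)).symm
  let T₃ := MeasurableEquiv.piFinSuccAbove (fun _ : Fin (n + 1) => ℝ) 0
  let T₄ := MeasurableEquiv.prodCongr (MeasurableEquiv.refl ℝ) (MeasurableEquiv.toLp 2 (Fin n → ℝ))
  have h₁ : MeasurePreserving T₁ volume volume := b.measurePreserving_repr
  have h₂ : MeasurePreserving T₂ volume volume :=
    EuclideanSpace.volume_preserving_symm_measurableEquiv_toLp _
  have h₃ : MeasurePreserving T₃ volume volume := volume_preserving_piFinSuccAbove _ 0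
  have h₄ : MeasurePreserving T₄ volume volume :=
    (MeasurePreserving.id volume).prod (PiLp.volume_preserving_toLp (Fin n))
  refine ⟨((T₁.trans T₂).trans T₃).trans T₄, h₄.comp (h₃.comp (h₂.comp h₁)), fun x => ?_,
    fun x y => ?_⟩
  · change b.repr x 0 = _
    rw [b.repr_apply_apply, hb0]
  · change _ = (b.repr x 0 - b.repr y 0) ^ 2 +
      dist (WithLp.toLp 2 fun j : Fin n => b.repr x j.succ)
        (WithLp.toLp 2 fun j : Fin n => b.repr y j.succ) ^ 2
    rw [← b.repr.dist_map x y, EuclideanSpace.dist_sq_eq, EuclideanSpace.dist_sq_eq,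
      Fin.sum_univ_succ, Real.dist_eq, sq_abs]

/-- Cavalieri bound: a set containing a ball of radius `R` centred at each height in `(α, β]` has
at least the volume of the corresponding cylinder between these heights. -/
lemma mul_volume_ball_le_volume_slab {n : ℕ} {e : EuclideanSpace ℝ (Fin (n + 1))} (he : ‖e‖ = 1)
    {s : Set (EuclideanSpace ℝ (Fin (n + 1)))} (hs : MeasurableSet s) {α β R : ℝ}
    (h : ∀ t ∈ Ioc α β, ∃ p, inner ℝ e p = t ∧ ball p R ⊆ s) :
    ENNReal.ofReal (β - α) * volume (ball (0 : EuclideanSpace ℝ (Fin n)) R) ≤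
      volume (s ∩ {x | inner ℝ e x ∈ Ioc α β}) := by
  obtain ⟨T, hT, hT₁, hdist⟩ := exists_measurePreserving_splitting e he
  have hm : MeasurableSet (s ∩ {x | inner ℝ e x ∈ Ioc α β}) :=
    hs.inter (measurableSet_Ioc.preimage (by fun_prop))
  rw [← hT.symm.measure_preimage hm.nullMeasurableSet, Measure.volume_eq_prod,
    Measure.prod_apply (T.symm.measurable hm)]
  calc ENNReal.ofReal (β - α) * volume (ball (0 : EuclideanSpace ℝ (Fin n)) R)
      = ∫⁻ _ in Ioc α β, volume (ball (0 : EuclideanSpace ℝ (Fin n)) R) := by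
        rw [setLIntegral_const, Real.volume_Ioc, mul_comm]
    _ ≤ ∫⁻ t in Ioc α β, volume (Prod.mk t ⁻¹' (T.symm ⁻¹' (s ∩ {x | inner ℝ e x ∈ Ioc α β}))) := by
        refine setLIntegral_mono' measurableSet_Ioc fun t ht => ?_
        obtain ⟨p, hpt, hp⟩ := h t ht
        rw [← Measure.addHaar_ball_center volume (T p).2]
        refine measure_mono fun v hv => ?_
        have hfst : inner ℝ e (T.symm (t, v)) = t := by rw [← hT₁]; simp
        refine ⟨hp ?_, ?_⟩
        · have hd := hdist (T.symm (t, v)) p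
          rw [hT₁, hT₁, hfst, hpt, sub_self, T.apply_symm_apply] at hd
          have : dist (T.symm (t, v)) p = dist v (T p).2 :=
            (pow_left_inj₀ dist_nonneg dist_nonneg two_ne_zero).1 (by simpa using hd)
          rw [mem_ball, this]
          exact hv
        · change inner ℝ e (T.symm (t, v)) ∈ Ioc α β
          rwa [hfst]
    _ ≤ _ := setLIntegral_le_lintegral _ _

/-- Volume bound for a set containing a moving ball of radius `R`: it has at least the volume of a
cylinder of radius `R` capped by two half-balls. -/
lemma capped_cylinder_volume_le {n : ℕ} {s : Set (EuclideanSpace ℝ (Fin (n + 1)))}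
    (hs : MeasurableSet s) {R : ℝ} {C : Set (EuclideanSpace ℝ (Fin (n + 1)))}
    (hC : IsPreconnected C) (hball : ∀ p ∈ C, ball p R ⊆ s)
    {a b : EuclideanSpace ℝ (Fin (n + 1))} (ha : a ∈ C) (hb : b ∈ C) :
    ENNReal.ofReal (dist a b) * volume (ball (0 : EuclideanSpace ℝ (Fin n)) R) +
      volume (ball (0 : EuclideanSpace ℝ (Fin (n + 1))) R) ≤ volume s := by
  rcases eq_or_ne a b with rfl | hab
  · rw [dist_self, ENNReal.ofReal_zero, zero_mul, zero_add,
      ← Measure.addHaar_ball_center volume a]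
    exact measure_mono (hball a ha)
  have hn : 0 < ‖b - a‖ := norm_pos_iff.2 (sub_ne_zero.2 hab.symm)
  set e := ‖b - a‖⁻¹ • (b - a) with he_def
  have he : ‖e‖ = 1 := by rw [norm_smul, norm_inv, norm_norm, inv_mul_cancel₀ hn.ne']
  have hL : inner ℝ e b - inner ℝ e a = dist a b := by
    rw [← inner_sub_right, he_def, real_inner_smul_left, real_inner_self_eq_norm_sq, dist_comm,
      dist_eq_norm]
    field_simp
  have hle : inner ℝ e a ≤ inner ℝ e b := by
    have := dist_nonneg (x := a) (y := b); linarith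
  have hmeas : Measurable fun x => inner ℝ e x := by fun_prop
  have hlow : MeasurableSet {x | inner ℝ e x ≤ inner ℝ e a} :=
    measurableSet_Iic.preimage hmeas
  have hmid := mul_volume_ball_le_volume_slab he hs (α := inner ℝ e a) (β := inner ℝ e b) (R := R)
    fun t ht => by
      obtain ⟨p, hp, hpt⟩ := hC.intermediate_value ha hb (f := fun x => inner ℝ e x)
        (by fun_prop) ⟨ht.1.le, ht.2⟩
      exact ⟨p, hpt, hball p hp⟩
  rw [hL] at hmid
  have hcap : volume (ball b R ∩ {x | inner ℝ e x ≤ inner ℝ e b}ᶜ) =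
      volume (ball a R ∩ {x | inner ℝ e x ≤ inner ℝ e a}ᶜ) := by
    rw [← measure_preimage_add_right volume (b - a)]
    congr 1
    ext x
    have h₁ : dist (x + (b - a)) b = dist x a := by
      rw [dist_eq_norm, dist_eq_norm]; congr 1; abel
    have h₂ : inner ℝ e (x + (b - a)) = inner ℝ e x + (inner ℝ e b - inner ℝ e a) := by
      rw [inner_add_right, inner_sub_right]
    simp only [mem_preimage, mem_inter_iff, mem_ball, mem_compl_iff, mem_ofPred_eq, h₁, h₂]
    refine and_congr_right fun _ => not_congr ⟨fun h => ?_, fun h => ?_⟩ <;> linarith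
  have hupper : MeasurableSet {x | inner ℝ e x ≤ inner ℝ e b} :=
    measurableSet_Iic.preimage hmeas
  calc _ = volume (ball a R ∩ {x | inner ℝ e x ≤ inner ℝ e a}) +
        ENNReal.ofReal (dist a b) * volume (ball (0 : EuclideanSpace ℝ (Fin n)) R) +
        volume (ball b R ∩ {x | inner ℝ e x ≤ inner ℝ e b}ᶜ) := by
        rw [hcap, ← Measure.addHaar_ball_center volume a,
          ← measure_inter_add_sdiff (ball a R) hlow, sdiff_eq]
        ring
    _ ≤ volume (s ∩ {x | inner ℝ e x ≤ inner ℝ e a}) +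
        volume (s ∩ {x | inner ℝ e x ∈ Ioc (inner ℝ e a) (inner ℝ e b)}) +
        volume (s ∩ {x | inner ℝ e x ≤ inner ℝ e b}ᶜ) := by
        gcongr
        exacts [hball a ha, hball b hb]
    _ = volume s := by
        rw [← measure_inter_add_sdiff s hupper, ← sdiff_eq]
        congr 1
        rw [← measure_inter_add_sdiff (s ∩ {x | inner ℝ e x ≤ inner ℝ e b}) hlow]
        congr 2
        · ext x
          simp only [mem_inter_iff, mem_ofPred_eq]
          exact ⟨fun h => ⟨⟨h.1, h.2.trans hle⟩, h.2⟩, fun h => ⟨h.1.1, h.2⟩⟩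
        · ext x
          simp only [mem_inter_iff, mem_ofPred_eq, mem_Ioc, Set.mem_sdiff, not_le]
          tauto

theorem component_bounded_and_diam_bound (m : ℕ) (hm : 2 ≤ m)
    (D : Set (EuclideanSpace ℝ (Fin m))) (hD : IsOpen D)
    (R : ℝ) (hR : 0 < R) (hsmooth : HasRSmoothBoundary m D R) (hvol : volume D < ⊤)
    (Di : Set (EuclideanSpace ℝ (Fin m))) (hDi : ∃ x ∈ D, Di = connectedComponentIn D x) :
    Bornology.IsBounded Di ∧
      Metric.diam Di ≤
        ((volume Di).toReal +
            (2 * (volume (ball (0 : EuclideanSpace ℝ (Fin (m - 1))) 1)).toReal -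
              (volume (ball (0 : EuclideanSpace ℝ (Fin m)) 1)).toReal) * R ^ m) /
          ((volume (ball (0 : EuclideanSpace ℝ (Fin (m - 1))) 1)).toReal * R ^ (m - 1)) := by
  obtain ⟨n, rfl⟩ : ∃ n, m = n + 1 := ⟨m - 1, by omega⟩
  obtain ⟨x₀, hx₀, rfl⟩ := hDi
  change _ ∧ Metric.diam (connectedComponentIn D x₀) ≤
    ((volume (connectedComponentIn D x₀)).toReal +
      (2 * (volume (ball (0 : EuclideanSpace ℝ (Fin n)) 1)).toReal -
        (volume (ball (0 : EuclideanSpace ℝ (Fin (n + 1))) 1)).toReal) * R ^ (n + 1)) /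
    ((volume (ball (0 : EuclideanSpace ℝ (Fin n)) 1)).toReal * R ^ n)
  have : Nonempty (Fin n) := ⟨⟨0, by omega⟩⟩
  set ω := (volume (ball (0 : EuclideanSpace ℝ (Fin n)) 1)).toReal with hω
  set ω' := (volume (ball (0 : EuclideanSpace ℝ (Fin (n + 1))) 1)).toReal with hω'
  have hωpos : 0 < ω := ENNReal.toReal_pos (measure_ball_pos _ _ one_pos).ne' measure_ball_lt_top.ne
  set K := connectedComponentIn D x₀
  have hne : Dᶜ.Nonempty := by
    rw [nonempty_compl]
    rintro rfl
    simp at hvol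
  obtain ⟨r, hrc, hr⟩ := hsmooth.exists_continuousOn_retraction hD hR hne
  have hKD : K ⊆ D := connectedComponentIn_subset D x₀
  have hK : IsPreconnected K := isPreconnected_connectedComponentIn
  have hKvol : volume K ≠ ⊤ := ((measure_mono hKD).trans_lt hvol).ne
  have hball : ∀ p ∈ r '' K, ball p R ⊆ K := by
    rintro _ ⟨x, hx, rfl⟩
    have h := (convex_ball (r x) R).isPreconnected.subset_connectedComponentIn
      (mem_ball.2 (hr x (hKD hx)).1) (hr x (hKD hx)).2
    rwa [← connectedComponentIn_eq hx] at h
  have hdist : ∀ x ∈ K, ∀ y ∈ K, dist x y ≤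
      ((volume K).toReal + (2 * ω - ω') * R ^ (n + 1)) / (ω * R ^ n) := by
    intro x hx y hy
    have hvolK := capped_cylinder_volume_le hD.connectedComponentIn.measurableSet
      (hK.image r (hrc.mono hKD)) hball (mem_image_of_mem r hx) (mem_image_of_mem r hy)
    rw [Measure.addHaar_ball volume _ hR.le, Measure.addHaar_ball volume _ hR.le] at hvolK
    have hreal := ENNReal.toReal_mono hKvol hvolK
    rw [ENNReal.toReal_add (by finiteness) (by finiteness), ENNReal.toReal_mul,
      ENNReal.toReal_mul, ENNReal.toReal_mul, ENNReal.toReal_ofReal dist_nonneg,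
      ENNReal.toReal_ofReal (by positivity), ENNReal.toReal_ofReal (by positivity),
      finrank_euclideanSpace_fin, finrank_euclideanSpace_fin, ← hω, ← hω'] at hreal
    have hxy : dist x y ≤ dist (r x) (r y) + 2 * R := by
      have h₁ := dist_triangle4 x (r x) (r y) y
      have h₂ := (hr x (hKD hx)).1
      have h₃ := (hr y (hKD hy)).1
      rw [dist_comm] at h₃
      linarith
    have hpos : 0 < ω * R ^ n := by positivity
    rw [le_div_iff₀ hpos]
    have := mul_le_mul_of_nonneg_right hxy hpos.le
    rw [pow_succ] at hreal ⊢
    linarith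
  exact ⟨isBounded_iff.2 ⟨_, fun x hx y hy => hdist x hx y hy⟩,
    diam_le_of_forall_dist_le_of_nonempty ⟨x₀, mem_connectedComponentIn hx₀⟩ hdist⟩
end

section
/- Let D be an open subset of ℝ^m, m ≥ 2, with R-smooth boundary ∂D, let t > 0, and let x ∈ D satisfy δ(x) < R/2. Then ∫_D p(x,y;t) dy ≥ 1 − (4πt)^{−1/2}·∫_{δ(x)}^∞ e^{−ζ²/(4t)} dζ − (√2/2)·e^{−R²/(8t)} − (4πt)^{−m/2}·∫_{−R}^{δ(x)} e^{−ζ²/(4t)} (∫_{{ζ̂ ∈ ℝ^{m−1} : |ζ̂| > ((δ(x)−ζ)R/2)^{1/2}}} e^{−|ζ̂|²/(4t)} dζ̂) dζ. -/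
open MeasureTheory Metric Set

/-- If `‖p‖ ≤ a`, `‖v‖ ≤ b` and `‖p - v‖ ≥ a + b`, then `p` and `v` point in opposite
directions. -/
lemma smul_add_smul_eq_zero_of_add_le_norm_sub {V : Type*} [NormedAddCommGroup V]
    [InnerProductSpace ℝ V] {p v : V} {a b : ℝ} (ha : 0 ≤ a) (hb : 0 ≤ b)
    (hp : ‖p‖ ≤ a) (hv : ‖v‖ ≤ b) (h : a + b ≤ ‖p - v‖) : b • p + a • v = 0 := by
  have h1 := norm_sub_sq_real p v
  have h2 := norm_add_sq_real (b • p) (a • v)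
  rw [norm_smul, norm_smul, inner_smul_left, inner_smul_right, Real.norm_of_nonneg ha,
    Real.norm_of_nonneg hb] at h2
  simp only [conj_trivial] at h2
  have h3 : (a + b) ^ 2 ≤ ‖p - v‖ ^ 2 := pow_le_pow_left₀ (by positivity) h 2
  have h4 : ‖p‖ ^ 2 ≤ a ^ 2 := pow_le_pow_left₀ (norm_nonneg _) hp 2
  have h5 : ‖v‖ ^ 2 ≤ b ^ 2 := pow_le_pow_left₀ (norm_nonneg _) hv 2
  have h6 : inner ℝ p v ≤ -(a * b) := by nlinarith
  have h7 : ‖b • p + a • v‖ ^ 2 ≤ 0 := by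
    have e1 := mul_le_mul_of_nonneg_left h4 (sq_nonneg b)
    have e2 := mul_le_mul_of_nonneg_left h5 (sq_nonneg a)
    have e3 := mul_le_mul_of_nonneg_left h6 (mul_nonneg ha hb)
    nlinarith
  exact norm_eq_zero.1 (pow_eq_zero_iff two_ne_zero |>.1 (le_antisymm h7 (sq_nonneg _)))

/-- If `D` has `R`-smooth boundary and `x ∈ D`, then `D` contains a ball of radius `R` whose
centre lies at distance `R` from a boundary point nearest to `x`, on the normal through `x`. -/
lemma HasRSmoothBoundary.exists_ball_subset {m : ℕ} {D : Set (EuclideanSpace ℝ (Fin m))} {R : ℝ}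
    (hsmooth : HasRSmoothBoundary m D R) (hD : IsOpen D) (hR : 0 < R)
    {x : EuclideanSpace ℝ (Fin m)} (hx : x ∈ D) (hne : Dᶜ.Nonempty) :
    ∃ ν : EuclideanSpace ℝ (Fin m), ‖ν‖ = 1 ∧ ball (x + (infDist x Dᶜ - R) • ν) R ⊆ D := by
  obtain ⟨y, hyD, hxy⟩ := hD.isClosed_compl.exists_infDist_eq_dist hne x
  set δ := infDist x Dᶜ
  have hδ0 : 0 < δ := by
    rw [hxy, dist_pos]
    rintro rfl
    exact hyD hx
  have hball : ball x δ ⊆ D := by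
    have := disjoint_ball_infDist (x := x) (s := Dᶜ)
    exact disjoint_compl_right_iff_subset.1 this
  have hyf : y ∈ frontier D := by
    rw [hD.frontier_eq]
    refine ⟨closure_mono hball ?_, hyD⟩
    rw [closure_ball x hδ0.ne', mem_closedBall, dist_comm]
    exact hxy.ge
  obtain ⟨c₁, c₂, h1, h2, h12⟩ := hsmooth y hyf
  rw [closure_ball _ hR.ne', closure_ball _ hR.ne'] at h12
  have hy : y ∈ closedBall c₁ R ∩ closedBall c₂ R := h12 ▸ mem_singleton y
  have hu : ‖c₁ - y‖ ≤ R := by simpa [dist_eq_norm, norm_sub_rev] using hy.1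
  have hv : ‖c₂ - y‖ ≤ R := by simpa [dist_eq_norm, norm_sub_rev] using hy.2
  have hdisj : Disjoint D (ball c₂ R) :=
    disjoint_left.2 fun z hz hz' => h2 hz' (subset_closure hz)
  have huv : R + R ≤ ‖(c₁ - y) - (c₂ - y)‖ := by
    have := (disjoint_ball_ball_iff hR hR).1 (hdisj.mono_left h1)
    rwa [sub_sub_sub_cancel_right, ← dist_eq_norm]
  have hpv : δ + R ≤ ‖(x - y) - (c₂ - y)‖ := by
    have := (disjoint_ball_ball_iff hδ0 hR).1 (hdisj.mono_left hball)
    rwa [sub_sub_sub_cancel_right, ← dist_eq_norm]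
  have e1 := smul_add_smul_eq_zero_of_add_le_norm_sub hR.le hR.le hu hv huv
  have e2 := smul_add_smul_eq_zero_of_add_le_norm_sub hδ0.le hR.le
    (by rw [← dist_eq_norm]; exact hxy.ge) hv hpv
  have hnv : ‖c₂ - y‖ = R := by
    have := norm_sub_le (c₁ - y) (c₂ - y)
    linarith
  refine ⟨R⁻¹ • (c₂ - y), ?_, ?_⟩
  · rw [norm_smul, hnv, Real.norm_of_nonneg (by positivity), inv_mul_cancel₀ hR.ne']
  · have e3 : c₁ - y = -(c₂ - y) := by
      rw [← smul_add] at e1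
      exact eq_neg_of_add_eq_zero_left ((smul_eq_zero.1 e1).resolve_left hR.ne')
    have e4 : x - y = -((δ * R⁻¹) • (c₂ - y)) := by
      have : R⁻¹ • (R • (x - y) + δ • (c₂ - y)) = 0 := by rw [e2, smul_zero]
      rw [smul_add, smul_smul, smul_smul, inv_mul_cancel₀ hR.ne', one_smul, mul_comm] at this
      exact eq_neg_of_add_eq_zero_left this
    have : x + (δ - R) • R⁻¹ • (c₂ - y) = c₁ := by
      rw [smul_smul, sub_mul, mul_inv_cancel₀ hR.ne', sub_smul, one_smul]
      have : x = y + -((δ * R⁻¹) • (c₂ - y)) := by rw [← e4]; abel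
      have : c₁ = y + -(c₂ - y) := by rw [← e3]; abel
      rw [this]
      nth_rewrite 1 [‹x = _›]
      abel
    rwa [this]

/-- Coordinates on `ℝ^(k+1)` centred at `x`, with first axis along the unit vector `ν`. -/
lemma exists_measurePreserving_normal_coordinates {k : ℕ} (x ν : EuclideanSpace ℝ (Fin (k + 1)))
    (hν : ‖ν‖ = 1) :
    ∃ Φ : ℝ × EuclideanSpace ℝ (Fin k) ≃ᵐ EuclideanSpace ℝ (Fin (k + 1)),
      MeasurePreserving Φ ∧
        ∀ a ζ w, dist (Φ (ζ, w)) (x + a • ν) ^ 2 = (ζ - a) ^ 2 + ‖w‖ ^ 2 := by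
  have hortho : Orthonormal ℝ (({0} : Set (Fin (k + 1))).domRestrict fun _ => ν) :=
    ⟨fun _ => hν, fun i j hij => absurd (Subsingleton.elim i j) hij⟩
  obtain ⟨b, hb⟩ := hortho.exists_orthonormalBasis_extension_of_card_eq (by simp)
  have hb0 : b 0 = ν := hb 0 rfl
  refine ⟨((MeasurableEquiv.refl ℝ).prodCongr (MeasurableEquiv.toLp 2 (Fin k → ℝ)).symm).trans
    ((MeasurableEquiv.piFinSuccAbove (fun _ => ℝ) 0).symm.trans
      ((MeasurableEquiv.toLp 2 (Fin (k + 1) → ℝ)).trans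
        (b.measurableEquiv.symm.trans (MeasurableEquiv.addLeft x)))), ?_, ?_⟩
  · have m1 := (MeasurePreserving.id (volume : Measure ℝ)).prod
      (EuclideanSpace.volume_preserving_symm_measurableEquiv_toLp (Fin k))
    have m2 := (volume_preserving_piFinSuccAbove (fun _ : Fin (k + 1) => ℝ) 0).symm
    have m3 := (EuclideanSpace.volume_preserving_symm_measurableEquiv_toLp (Fin (k + 1))).symm
    have m4 := b.measurePreserving_measurableEquiv.symm
    have m5 := measurePreserving_add_left
      (volume : Measure (EuclideanSpace ℝ (Fin (k + 1)))) x
    exact m5.comp (m4.comp (m3.comp (m2.comp m1)))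
  · intro a ζ w
    have hΦ : dist (x + b.repr.symm (WithLp.toLp 2 (Fin.cons ζ w.ofLp))) (x + a • ν) ^ 2
        = (ζ - a) ^ 2 + ‖w‖ ^ 2 := by
      rw [dist_add_left, ← b.repr.dist_map, LinearIsometryEquiv.apply_symm_apply, map_smul,
        ← hb0, b.repr_self, EuclideanSpace.dist_sq_eq, Fin.sum_univ_succ,
        EuclideanSpace.norm_sq_eq]
      simp [Real.dist_eq]
    convert hΦ using 4
    change x + b.repr.symm (WithLp.toLp 2 (Fin.insertNth 0 ζ w.ofLp)) = _
    rw [Fin.insertNth_zero]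
    rfl

/-- The normalised Gaussian integral with variance `2 * t`. -/
lemma integral_exp_neg_norm_sq_div {V : Type*} [NormedAddCommGroup V] [InnerProductSpace ℝ V]
    [FiniteDimensional ℝ V] [MeasurableSpace V] [BorelSpace V] {t : ℝ} (ht : 0 < t) :
    ∫ v : V, Real.exp (-‖v‖ ^ 2 / (4 * t)) =
      (4 * Real.pi * t) ^ (Module.finrank ℝ V / 2 : ℝ) := by
  have := GaussianFourier.integral_rexp_neg_mul_sq_norm (V := V) (b := 1 / (4 * t))
    (by positivity)
  convert this using 2
  · ext v
    ring_nf
  · field_simp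

lemma integrable_exp_neg_norm_sq_div {V : Type*} [NormedAddCommGroup V] [InnerProductSpace ℝ V]
    [FiniteDimensional ℝ V] [MeasurableSpace V] [BorelSpace V] {t : ℝ} (ht : 0 < t) :
    Integrable fun v : V => Real.exp (-‖v‖ ^ 2 / (4 * t)) := by
  refine .of_integral_ne_zero ?_
  rw [integral_exp_neg_norm_sq_div ht]
  positivity

lemma integrable_exp_neg_sq_div {t : ℝ} (ht : 0 < t) :
    Integrable fun ζ : ℝ => Real.exp (-ζ ^ 2 / (4 * t)) := by
  simpa using integrable_exp_neg_norm_sq_div (V := ℝ) ht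

/-- A Gaussian tail bound. -/
lemma setIntegral_Iic_neg_exp_neg_sq_div_le {t R : ℝ} (ht : 0 < t) (hR : 0 < R) :
    (4 * Real.pi * t) ^ (-(1 : ℝ) / 2) * (∫ ζ in Iic (-R), Real.exp (-ζ ^ 2 / (4 * t))) ≤
      Real.sqrt 2 / 2 * Real.exp (-R ^ 2 / (8 * t)) := by
  have hgauss : ∫ ζ in Ioi (0 : ℝ), Real.exp (-ζ ^ 2 / (8 * t)) =
      Real.sqrt (2 * (4 * Real.pi * t)) / 2 := by
    have := integral_gaussian_Ioi (1 / (8 * t))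
    convert this using 2
    · ext ζ
      ring_nf
    · congr 1
      field_simp
      ring
  have hint : Integrable fun ζ : ℝ => Real.exp (-ζ ^ 2 / (8 * t)) := by
    convert integrable_exp_neg_sq_div (t := 2 * t) (by positivity) using 4
    ring
  have hle : ∫ ζ in Ioi R, Real.exp (-ζ ^ 2 / (4 * t)) ≤
      Real.exp (-R ^ 2 / (8 * t)) * (Real.sqrt (2 * (4 * Real.pi * t)) / 2) := by
    rw [← hgauss, ← integral_const_mul]
    refine (setIntegral_mono_on (integrable_exp_neg_sq_div ht).integrableOn
      (hint.const_mul (Real.exp (-R ^ 2 / (8 * t)))).integrableOn measurableSet_Ioi ?_).trans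
      (setIntegral_mono_set (hint.const_mul _).integrableOn
        (Filter.Eventually.of_forall fun ζ => by positivity)
        (Ioi_subset_Ioi hR.le).eventuallyLE)
    intro ζ hζ
    rw [← Real.exp_add, Real.exp_le_exp, ← add_div, div_le_div_iff₀ (by positivity) (by positivity)]
    have : R ^ 2 ≤ ζ ^ 2 := pow_le_pow_left₀ hR.le (le_of_lt hζ) 2
    nlinarith
  have hneg : ∫ ζ in Iic (-R), Real.exp (-ζ ^ 2 / (4 * t)) =
      ∫ ζ in Ioi R, Real.exp (-ζ ^ 2 / (4 * t)) := by
    have := integral_comp_neg_Iic (-R) fun ζ => Real.exp (-ζ ^ 2 / (4 * t))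
    rw [neg_neg] at this
    rw [← this]
    refine integral_congr_ae (Filter.Eventually.of_forall fun ζ => ?_)
    change _ = Real.exp (-(-ζ) ^ 2 / (4 * t))
    rw [neg_sq]
  have hpos : 0 < 4 * Real.pi * t := by positivity
  rw [hneg]
  refine (mul_le_mul_of_nonneg_left hle (by positivity)).trans (le_of_eq ?_)
  rw [Real.sqrt_mul (by norm_num), Real.sqrt_eq_rpow (4 * Real.pi * t)]
  have : (4 * Real.pi * t) ^ (-(1 : ℝ) / 2) * (4 * Real.pi * t) ^ ((1 : ℝ) / 2) = 1 := by
    rw [← Real.rpow_add hpos]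
    norm_num
  linear_combination (Real.exp (-R ^ 2 / (8 * t)) * Real.sqrt 2 / 2) * this

lemma setIntegral_union_le_add {α : Type*} [MeasurableSpace α] {μ : Measure α} {f : α → ℝ}
    (hf : Integrable f μ) (hf0 : 0 ≤ f) (s : Set α) {u : Set α} (hu : MeasurableSet u) :
    ∫ a in s ∪ u, f a ∂μ ≤ (∫ a in s, f a ∂μ) + ∫ a in u, f a ∂μ := by
  rw [← sdiff_union_self, setIntegral_union disjoint_sdiff_left hu hf.integrableOn hf.integrableOn]
  gcongr
  · exact Filter.Eventually.of_forall hf0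
  · exact hf.integrableOn
  · exact sdiff_subset

lemma integrable_exp_mul_exp {k : ℕ} {t : ℝ} (ht : 0 < t) :
    Integrable fun p : ℝ × EuclideanSpace ℝ (Fin k) =>
      Real.exp (-p.1 ^ 2 / (4 * t)) * Real.exp (-‖p.2‖ ^ 2 / (4 * t)) :=
  (integrable_exp_neg_sq_div ht).mul_prod (integrable_exp_neg_norm_sq_div ht)

lemma integral_heatKernel {m : ℕ} {t : ℝ} (ht : 0 < t) (x : EuclideanSpace ℝ (Fin m)) :
    ∫ y, heatKernel m t x y = 1 := by
  have hpos : 0 < 4 * Real.pi * t := by positivity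
  simp only [heatKernel, dist_eq_norm]
  rw [integral_const_mul,
    integral_sub_left_eq_self (fun v => Real.exp (-‖v‖ ^ 2 / (4 * t))) volume x,
    integral_exp_neg_norm_sq_div ht, ← Real.rpow_add hpos, finrank_euclideanSpace_fin,
    ← add_div, neg_add_cancel, zero_div, Real.rpow_zero]

/-- The Gaussian mass of a ball of radius `R` tangent to the hyperplane `ζ = δ` from below,
written in coordinates `(ζ, w)` with the Gaussian centred at the origin. -/
lemma one_sub_le_setIntegral_capped_halfspace {k : ℕ} {t R δ : ℝ} (ht : 0 < t) (hR : 0 < R)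
    (hδ : δ < R / 2) :
    1 - (4 * Real.pi * t) ^ (-(1 : ℝ) / 2) * (∫ ζ in Ioi δ, Real.exp (-ζ ^ 2 / (4 * t)))
        - Real.sqrt 2 / 2 * Real.exp (-R ^ 2 / (8 * t))
        - (4 * Real.pi * t) ^ (-((k + 1 : ℕ) : ℝ) / 2) *
            (∫ ζ in Ioo (-R) δ, Real.exp (-ζ ^ 2 / (4 * t)) *
                ∫ w in {w : EuclideanSpace ℝ (Fin k) | Real.sqrt ((δ - ζ) * R / 2) < ‖w‖},
                  Real.exp (-‖w‖ ^ 2 / (4 * t))) ≤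
      (4 * Real.pi * t) ^ (-((k + 1 : ℕ) : ℝ) / 2) *
        ∫ p in {p : ℝ × EuclideanSpace ℝ (Fin k) | (p.1 - (δ - R)) ^ 2 + ‖p.2‖ ^ 2 < R ^ 2},
          Real.exp (-p.1 ^ 2 / (4 * t)) * Real.exp (-‖p.2‖ ^ 2 / (4 * t)) := by
  have hpos : 0 < 4 * Real.pi * t := by positivity
  set g : ℝ × EuclideanSpace ℝ (Fin k) → ℝ := fun p =>
    Real.exp (-p.1 ^ 2 / (4 * t)) * Real.exp (-‖p.2‖ ^ 2 / (4 * t)) with hg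
  have hgi : Integrable g := integrable_exp_mul_exp ht
  have hg0 : 0 ≤ g := fun p => by positivity
  set B : Set (ℝ × EuclideanSpace ℝ (Fin k)) :=
    {p | (p.1 - (δ - R)) ^ 2 + ‖p.2‖ ^ 2 < R ^ 2} with hB
  set S : Set (ℝ × EuclideanSpace ℝ (Fin k)) :=
    {p | p.1 ∈ Ioo (-R) δ ∧ Real.sqrt ((δ - p.1) * R / 2) < ‖p.2‖} with hS
  have hSm : MeasurableSet S := by
    refine (measurableSet_Ioo.preimage measurable_fst).inter
      (measurableSet_lt ?_ measurable_snd.norm)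
    fun_prop
  have hcover : (univ : Set (ℝ × EuclideanSpace ℝ (Fin k))) =
      B ∪ Ici δ ×ˢ univ ∪ Iic (-R) ×ˢ univ ∪ S := by
    refine (eq_univ_of_forall ?_).symm
    rintro ⟨ζ, w⟩
    simp only [hB, hS, mem_union, mem_prod, mem_univ, and_true, mem_Ici, mem_Iic, mem_Ioo,
      Set.mem_ofPred_eq]
    by_cases h1 : δ ≤ ζ
    · exact .inl (.inl (.inr h1))
    by_cases h2 : ζ ≤ -R
    · exact .inl (.inr h2)
    by_cases h3 : Real.sqrt ((δ - ζ) * R / 2) < ‖w‖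
    · exact .inr ⟨⟨not_le.1 h2, not_le.1 h1⟩, h3⟩
    refine .inl (.inl (.inl ?_))
    push Not at h1 h2 h3
    have hw : ‖w‖ ^ 2 ≤ (δ - ζ) * R / 2 := by
      have : 0 ≤ (δ - ζ) * R / 2 := by
        have := mul_pos (sub_pos.2 h1) hR
        positivity
      rw [← Real.sq_sqrt this]
      exact pow_le_pow_left₀ (norm_nonneg _) h3 2
    nlinarith [mul_pos (sub_pos.2 h1) (show 0 < R - 2 * δ + 2 * (ζ + R) by linarith)]
  have hmass : ∀ s : Set ℝ, ∫ p in s ×ˢ univ, g p =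
      (∫ ζ in s, Real.exp (-ζ ^ 2 / (4 * t))) * (4 * Real.pi * t) ^ ((k : ℝ) / 2) := by
    intro s
    have := setIntegral_prod_mul (μ := (volume : Measure ℝ))
      (ν := (volume : Measure (EuclideanSpace ℝ (Fin k))))
      (fun ζ => Real.exp (-ζ ^ 2 / (4 * t))) (fun w => Real.exp (-‖w‖ ^ 2 / (4 * t))) s univ
    rw [setIntegral_univ, integral_exp_neg_norm_sq_div ht, finrank_euclideanSpace_fin] at this
    exact this
  have hline : ∫ ζ : ℝ, Real.exp (-ζ ^ 2 / (4 * t)) = (4 * Real.pi * t) ^ ((1 : ℝ) / 2) := by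
    simpa using integral_exp_neg_norm_sq_div (V := ℝ) ht
  have htotal : ∫ p, g p = (4 * Real.pi * t) ^ ((1 : ℝ) / 2) *
      (4 * Real.pi * t) ^ ((k : ℝ) / 2) := by
    rw [← hline, ← setIntegral_univ, ← univ_prod_univ, hmass, setIntegral_univ]
  have hSint : ∫ p in S, g p = ∫ ζ in Ioo (-R) δ, Real.exp (-ζ ^ 2 / (4 * t)) *
      ∫ w in {w : EuclideanSpace ℝ (Fin k) | Real.sqrt ((δ - ζ) * R / 2) < ‖w‖},
        Real.exp (-‖w‖ ^ 2 / (4 * t)) := by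
    rw [← integral_indicator hSm, Measure.volume_eq_prod,
      integral_prod _ (hgi.indicator hSm), ← integral_indicator measurableSet_Ioo]
    refine integral_congr_ae (Filter.Eventually.of_forall fun ζ => ?_)
    by_cases hζ : ζ ∈ Ioo (-R) δ
    · have hwm : MeasurableSet
          {w : EuclideanSpace ℝ (Fin k) | Real.sqrt ((δ - ζ) * R / 2) < ‖w‖} :=
        measurableSet_lt measurable_const measurable_norm
      simp only [indicator_of_mem hζ]
      rw [← integral_const_mul, ← integral_indicator hwm]
      congr 1 with w
      simp only [indicator, hS, Set.mem_ofPred_eq, hζ, true_and, hg]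
    · simp only [indicator_of_notMem hζ]
      have : ∀ w, S.indicator g (ζ, w) = 0 := fun w =>
        indicator_of_notMem (fun h => hζ h.1) _
      simp [this]
  have hsum : ∫ p, g p ≤ (∫ p in B, g p) + (∫ p in Ici δ ×ˢ univ, g p) +
      (∫ p in Iic (-R) ×ˢ univ, g p) + ∫ p in S, g p := by
    rw [← setIntegral_univ, hcover]
    refine (setIntegral_union_le_add hgi hg0 _ hSm).trans (add_le_add_left ?_ _)
    refine (setIntegral_union_le_add hgi hg0 _ (measurableSet_Iic.prod .univ)).trans
      (add_le_add_left ?_ _)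
    exact setIntegral_union_le_add hgi hg0 _ (measurableSet_Ici.prod .univ)
  rw [htotal, hmass, hmass, hSint, integral_Ici_eq_integral_Ioi] at hsum
  have hC : (4 * Real.pi * t) ^ (-((k + 1 : ℕ) : ℝ) / 2) * (4 * Real.pi * t) ^ ((k : ℝ) / 2) =
      (4 * Real.pi * t) ^ (-(1 : ℝ) / 2) := by
    rw [← Real.rpow_add hpos]
    congr 1
    push_cast
    ring
  have h1 : (4 * Real.pi * t) ^ (-(1 : ℝ) / 2) * (4 * Real.pi * t) ^ ((1 : ℝ) / 2) = 1 := by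
    rw [← Real.rpow_add hpos]
    norm_num
  have htail := setIntegral_Iic_neg_exp_neg_sq_div_le ht hR
  have hCpos : 0 ≤ (4 * Real.pi * t) ^ (-((k + 1 : ℕ) : ℝ) / 2) := by positivity
  have hscaled := mul_le_mul_of_nonneg_left hsum hCpos
  simp only [mul_add] at hscaled
  rw [mul_left_comm, hC, mul_left_comm, hC, mul_left_comm _ (∫ ζ in Iic (-R), _), hC,
    mul_comm _ ((4 * Real.pi * t) ^ (-(1 : ℝ) / 2)), h1] at hscaled
  linarith

theorem pointwise_lower_bound (m : ℕ) (hm : 2 ≤ m)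
    (D : Set (EuclideanSpace ℝ (Fin m))) (hD : IsOpen D)
    (R : ℝ) (hR : 0 < R) (hsmooth : HasRSmoothBoundary m D R)
    (t : ℝ) (ht : 0 < t)
    (x : EuclideanSpace ℝ (Fin m)) (hx : x ∈ D) (hδ : Metric.infDist x Dᶜ < R / 2) :
    (∫ y in D, heatKernel m t x y) ≥
      1 - (4 * Real.pi * t) ^ (-(1 : ℝ) / 2) *
            (∫ ζ in Set.Ioi (Metric.infDist x Dᶜ), Real.exp (-ζ ^ 2 / (4 * t)))
        - Real.sqrt 2 / 2 * Real.exp (-R ^ 2 / (8 * t))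
        - (4 * Real.pi * t) ^ (-(m : ℝ) / 2) *
            (∫ ζ in Set.Ioo (-R) (Metric.infDist x Dᶜ),
              Real.exp (-ζ ^ 2 / (4 * t)) *
                ∫ w in {w : EuclideanSpace ℝ (Fin (m - 1)) |
                    Real.sqrt ((Metric.infDist x Dᶜ - ζ) * R / 2) < ‖w‖},
                  Real.exp (-‖w‖ ^ 2 / (4 * t))) := by
  rcases Dᶜ.eq_empty_or_nonempty with hempty | hne
  · rw [compl_empty_iff] at hempty
    have h1 : ∫ y in D, heatKernel m t x y = 1 := by
      rw [hempty, setIntegral_univ, integral_heatKernel ht]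
    rw [h1, ge_iff_le, sub_sub, sub_sub]
    refine sub_le_self _ ?_
    have h2 : 0 ≤ ∫ ζ in Ioi (infDist x Dᶜ), Real.exp (-ζ ^ 2 / (4 * t)) :=
      integral_nonneg fun ζ => by positivity
    have h3 : 0 ≤ ∫ ζ in Ioo (-R) (infDist x Dᶜ), Real.exp (-ζ ^ 2 / (4 * t)) *
        ∫ w in {w : EuclideanSpace ℝ (Fin (m - 1)) |
          Real.sqrt ((infDist x Dᶜ - ζ) * R / 2) < ‖w‖}, Real.exp (-‖w‖ ^ 2 / (4 * t)) :=
      integral_nonneg fun ζ => mul_nonneg (by positivity)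
        (integral_nonneg fun w => by positivity)
    positivity
  · obtain ⟨k, rfl⟩ : ∃ k, m = k + 1 := ⟨m - 1, by omega⟩
    obtain ⟨ν, hν, hball⟩ := hsmooth.exists_ball_subset hD hR hx hne
    obtain ⟨Φ, hΦ, hdist⟩ := exists_measurePreserving_normal_coordinates x ν hν
    set δ := infDist x Dᶜ
    have hbound := one_sub_le_setIntegral_capped_halfspace (k := k) ht hR hδ
    refine ge_iff_le.2 (hbound.trans ?_)
    have hker : ∀ p : ℝ × EuclideanSpace ℝ (Fin k), heatKernel (k + 1) t x (Φ p) =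
        (4 * Real.pi * t) ^ (-((k + 1 : ℕ) : ℝ) / 2) *
          (Real.exp (-p.1 ^ 2 / (4 * t)) * Real.exp (-‖p.2‖ ^ 2 / (4 * t))) := by
      rintro ⟨ζ, w⟩
      have := hdist 0 ζ w
      rw [zero_smul, add_zero, sub_zero, dist_comm] at this
      rw [heatKernel, this, ← Real.exp_add]
      ring_nf
    rw [← hΦ.setIntegral_preimage_emb Φ.measurableEmbedding]
    simp_rw [hker]
    rw [integral_const_mul]
    refine mul_le_mul_of_nonneg_left (setIntegral_mono_set
      (integrable_exp_mul_exp ht).integrableOn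
      (Filter.Eventually.of_forall fun p => by positivity)
      (LE.le.eventuallyLE ?_)) (by positivity)
    rintro ⟨ζ, w⟩ hp
    refine hball ?_
    refine lt_of_pow_lt_pow_left₀ 2 hR.le ?_
    rwa [hdist]
end
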